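/- Let T : ℝ^d × 𝒳 → 𝒳 be a continuous action of ℝ^d on a compact metric space (𝒳, 𝐝) with umdim_M(𝒳,T,𝐝) < ∞. Let λ be a Borel probability measure on M^T(𝒳) and let μ = ∫_{M^T(𝒳)} ν dλ(ν) be its barycenter. If rdim(𝒳,T,𝐝,ν) exists (i.e. urdim = lrdim) for λ-almost every ν ∈ M^T(𝒳), then rdim(𝒳,T,𝐝,μ) also exists and rdim(𝒳,T,𝐝,μ) = ∫_{M^T(𝒳)} rdim(𝒳,T,𝐝,ν) dλ(ν). -/

import Mathlib

open MeasureTheory Filter Set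
open scoped ENNReal Topology NNReal

noncomputable section

/-- Shannon entropy (base 2) of a finitely-valued random variable. -/
def shannonEntropy {Ω S : Type*} [MeasurableSpace Ω] [Fintype S]
    (P : Measure Ω) (f : Ω → S) : ℝ :=
  -∑ i : S, ((P (f ⁻¹' {i})).toReal * Real.logb 2 ((P (f ⁻¹' {i})).toReal))

/-- Mutual information (base 2) of two random variables, defined as the supremum over all
finite measurable partitions (encoded as measurable maps into `Fin n`) of
`H(α∘X) + H(β∘Y) - H(α∘X, β∘Y)`. -/
def mutualInfo {Ω A B : Type*} [MeasurableSpace Ω] [MeasurableSpace A] [MeasurableSpace B]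
    (P : Measure Ω) (X : Ω → A) (Y : Ω → B) : ℝ≥0∞ :=
  ⨆ (n : ℕ) (m : ℕ) (α : A → Fin n) (_ : Measurable α) (β : B → Fin m) (_ : Measurable β),
    ENNReal.ofReal (shannonEntropy P (fun ω => α (X ω)) + shannonEntropy P (fun ω => β (Y ω))
      - shannonEntropy P (fun ω => (α (X ω), β (Y ω))))

/-- The box `[0,L)^d ⊆ ℝ^d`. -/
def unitBox (d : ℕ) (L : ℝ) : Set (Fin d → ℝ) := Set.univ.pi fun _ => Set.Ico (0 : ℝ) L

/-- Lebesgue measure on `ℝ^d` restricted to the box `[0,L)^d`. -/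
def boxMeasure (d : ℕ) (L : ℝ) : Measure (Fin d → ℝ) := volume.restrict (unitBox d L)

/-- The space `L¹([0,L)^d, X)` of measurable maps modulo a.e. equality. -/
abbrev L1Maps (d : ℕ) (L : ℝ) (X : Type*) [TopologicalSpace X] :=
  (Fin d → ℝ) →ₘ[boxMeasure d L] X

/-- The `L¹` distance `D(f,g) = ∫_{[0,L)^d} 𝐝(f(u), g(u)) dm(u)`. -/
def L1dist {d : ℕ} {L : ℝ} {X : Type*} [MetricSpace X] (f g : L1Maps d L X) : ℝ :=
  ∫ u, dist (f u) (g u) ∂(boxMeasure d L)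

/-- The Borel σ-algebra of the metric `L1dist` on `L¹([0,L)^d, X)`,
generated by the open balls of the metric. -/
instance L1Maps.measurableSpace {d : ℕ} {L : ℝ} {X : Type*} [MetricSpace X] :
    MeasurableSpace (L1Maps d L X) :=
  MeasurableSpace.generateFrom {s | ∃ (f : L1Maps d L X) (r : ℝ), s = {g | L1dist f g < r}}

/-- The expected mean distortion `E[(1/L^d) ∫_{[0,L)^d} 𝐝(T^u X, Y_u) dm(u)]`. -/
def distortion {X : Type*} [MetricSpace X] (d : ℕ) (T : (Fin d → ℝ) → X → X) (L : ℝ)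
    {Ω : Type*} [MeasurableSpace Ω] (P : Measure Ω) (Xv : Ω → X) (Yv : Ω → L1Maps d L X) : ℝ :=
  ∫ ω, (L ^ d)⁻¹ * ∫ u, dist (T u (Xv ω)) (Yv ω u) ∂(boxMeasure d L) ∂P

/-- `R_L(𝐝, μ, ε)`: the infimum of `I(X;Y)` over all pairs of random variables on a common
probability space with `Law X = μ`, `Y` taking values in `L¹([0,L)^d, X)` and expected mean
distortion `< ε`. -/
def RL {X : Type*} [MetricSpace X] [MeasurableSpace X] (d : ℕ)
    (T : (Fin d → ℝ) → X → X) (μ : Measure X) (L ε : ℝ) : ℝ≥0∞ :=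
  ⨅ (Ω : Type) (_ : MeasurableSpace Ω) (P : Measure Ω) (_ : IsProbabilityMeasure P)
    (Xv : Ω → X) (Yv : Ω → L1Maps d L X) (_ : Measurable Xv) (_ : Measurable Yv)
    (_ : Measure.map Xv P = μ) (_ : distortion d T L P Xv Yv < ε),
    mutualInfo P Xv Yv

/-- The rate distortion function `R(𝐝, μ, ε) = lim_{L→∞} R_L(𝐝, μ, ε)/L^d`, which exists and
equals `inf_{L>0} R_L(𝐝, μ, ε)/L^d`. -/
def RD {X : Type*} [MetricSpace X] [MeasurableSpace X] (d : ℕ)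
    (T : (Fin d → ℝ) → X → X) (μ : Measure X) (ε : ℝ) : ℝ≥0∞ :=
  ⨅ (L : ℝ) (_ : 0 < L), RL d T μ L ε / ENNReal.ofReal (L ^ d)

/-- Upper rate distortion dimension. -/
def urdim {X : Type*} [MetricSpace X] [MeasurableSpace X] (d : ℕ)
    (T : (Fin d → ℝ) → X → X) (μ : Measure X) : ℝ≥0∞ :=
  Filter.limsup (fun ε : ℝ => RD d T μ ε / ENNReal.ofReal (Real.logb 2 (1 / ε))) (𝓝[>] (0 : ℝ))

/-- Lower rate distortion dimension. -/
def lrdim {X : Type*} [MetricSpace X] [MeasurableSpace X] (d : ℕ)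
    (T : (Fin d → ℝ) → X → X) (μ : Measure X) : ℝ≥0∞ :=
  Filter.liminf (fun ε : ℝ => RD d T μ ε / ENNReal.ofReal (Real.logb 2 (1 / ε))) (𝓝[>] (0 : ℝ))

/-- `μ` is invariant under the `ℝ^d`-action `T`. -/
def MeasInvariant {X : Type*} [MeasurableSpace X] (d : ℕ)
    (T : (Fin d → ℝ) → X → X) (μ : Measure X) : Prop :=
  ∀ u : Fin d → ℝ, Measure.map (T u) μ = μ

/-- `T` is a continuous action of the additive group `ℝ^d`. -/
def IsContAction {X : Type*} [TopologicalSpace X] (d : ℕ) (T : (Fin d → ℝ) → X → X) : Prop :=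
  Continuous (fun p : (Fin d → ℝ) × X => T p.1 p.2) ∧ (∀ x, T 0 x = x) ∧
    ∀ u v x, T (u + v) x = T u (T v x)

/-- The metric `𝐝_L(x,y) = sup_{u ∈ [0,L)^d} 𝐝(T^u x, T^u y)`. -/
def dSup {X : Type*} [MetricSpace X] (d : ℕ) (T : (Fin d → ℝ) → X → X) (L : ℝ) (x y : X) : ℝ :=
  ⨆ u : unitBox d L, dist (T u.1 x) (T u.1 y)

/-- The `ε`-covering number of `X` for the (pre)metric `ρ`: the minimal number of open sets
of `ρ`-diameter `< ε` covering `X`. -/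
def covNum (X : Type*) [TopologicalSpace X] (ρ : X → X → ℝ) (ε : ℝ) : ℕ :=
  sInf {n : ℕ | ∃ F : Finset (Set X), F.card = n ∧
    (∀ U ∈ F, IsOpen U ∧ (⨆ x ∈ U, ⨆ y ∈ U, ENNReal.ofReal (ρ x y)) < ENNReal.ofReal ε) ∧
    ⋃₀ (F : Set (Set X)) = Set.univ}

/-- The entropy at scale `ε`: `S(X,T,𝐝,ε) = lim_{L→∞} log₂ #(X, 𝐝_L, ε) / L^d`
(the limit exists, hence equals the limsup used here). -/
def entScale {X : Type*} [MetricSpace X] (d : ℕ) (T : (Fin d → ℝ) → X → X) (ε : ℝ) : ℝ≥0∞ :=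
  Filter.limsup
    (fun L : ℝ => ENNReal.ofReal (Real.logb 2 (covNum X (dSup d T L) ε) / L ^ d)) Filter.atTop

/-- The upper metric mean dimension. -/
def umdim {X : Type*} [MetricSpace X] (d : ℕ) (T : (Fin d → ℝ) → X → X) : ℝ≥0∞ :=
  Filter.limsup (fun ε : ℝ => entScale d T ε / ENNReal.ofReal (Real.logb 2 (1 / ε))) (𝓝[>] (0 : ℝ))

/-- The σ-algebra on the space of Borel probability measures on `X` (for a compact metric `X`
this is the Borel σ-algebra of the weak* topology). -/
instance ProbabilityMeasure.measurableSpace' {α : Type*} [MeasurableSpace α] :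
    MeasurableSpace (ProbabilityMeasure α) :=
  inferInstanceAs (MeasurableSpace {μ : Measure α // IsProbabilityMeasure μ})

/-- The space `M^T(X)` of `T`-invariant Borel probability measures on `X`. -/
abbrev InvM (X : Type*) [MeasurableSpace X] [MetricSpace X] (d : ℕ)
    (T : (Fin d → ℝ) → X → X) :=
  {ν : ProbabilityMeasure X // MeasInvariant d T (ν : Measure X)}

end


open MeasureTheory Filter Set
open scoped ENNReal Topology NNReal

namespace RDB

noncomputable section

/-- Unnormalised Shannon entropy (natural logarithm) of a finite vector. -/
def Hn {S : Type*} [Fintype S] (q : S → ℝ) : ℝ := ∑ s, Real.negMulLog (q s)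

/-- Mutual information of a finite joint distribution (natural logarithm). -/
def MI {U V : Type*} [Fintype U] [Fintype V] (r : U → V → ℝ) : ℝ :=
  Hn (fun u => ∑ v, r u v) + Hn (fun v => ∑ u, r u v) - Hn (fun p : U × V => r p.1 p.2)

theorem log_sum_ineq {ι : Type*} (s : Finset ι) (a b : ι → ℝ) (ha : ∀ i ∈ s, 0 ≤ a i)
    (hb : ∀ i ∈ s, 0 ≤ b i) (hab : ∀ i ∈ s, b i = 0 → a i = 0) :
    (∑ i ∈ s, a i) * (Real.log (∑ i ∈ s, a i) - Real.log (∑ i ∈ s, b i)) ≤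
      ∑ i ∈ s, a i * (Real.log (a i) - Real.log (b i)) := by
  set A := ∑ i ∈ s, a i with hA
  set B := ∑ i ∈ s, b i with hB
  have hA0 : 0 ≤ A := Finset.sum_nonneg ha
  have hB0 : 0 ≤ B := Finset.sum_nonneg hb
  rcases hA0.eq_or_lt with hA1 | hA1
  · have : ∀ i ∈ s, a i = 0 := (Finset.sum_eq_zero_iff_of_nonneg ha).1 hA1.symm
    rw [← hA1, Finset.sum_eq_zero]
    · simp
    · intro i hi; simp [this i hi]
  have hB1 : 0 < B := by
    rcases hB0.eq_or_lt with h | h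
    · have h2 : ∀ i ∈ s, b i = 0 := (Finset.sum_eq_zero_iff_of_nonneg hb).1 h.symm
      have : A = 0 := Finset.sum_eq_zero fun i hi => hab i hi (h2 i hi)
      linarith
    · exact h
  have key : ∀ i ∈ s, a i * (Real.log A - Real.log B) + (a i - b i * (A / B)) ≤
      a i * (Real.log (a i) - Real.log (b i)) := by
    intro i hi
    rcases (ha i hi).eq_or_lt with h | h
    · rw [← h]
      have := mul_nonneg (hb i hi) (div_nonneg hA0 hB0)
      simp; linarith
    · have hbi : 0 < b i := lt_of_le_of_ne (hb i hi) (fun h0 => h.ne' (hab i hi h0.symm))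
      have h1 := Real.log_le_sub_one_of_pos (x := (b i * A) / (a i * B)) (by positivity)
      rw [Real.log_div (by positivity) (by positivity), Real.log_mul hbi.ne' hA1.ne',
        Real.log_mul h.ne' hB1.ne'] at h1
      have h2 : a i * ((b i * A) / (a i * B)) = b i * (A / B) := by field_simp
      nlinarith [mul_le_mul_of_nonneg_left h1 h.le]
  have := Finset.sum_le_sum key
  rw [Finset.sum_add_distrib, Finset.sum_sub_distrib, ← Finset.sum_mul, ← Finset.sum_mul,
    ← hA, ← hB] at this
  have h3 : B * (A / B) = A := by field_simp
  linarith

theorem MI_eq {U V : Type*} [Fintype U] [Fintype V] (r : U → V → ℝ) (hr : ∀ u v, 0 ≤ r u v) :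
    MI r = ∑ p : U × V, r p.1 p.2 * (Real.log (r p.1 p.2) -
      Real.log ((∑ v, r p.1 v) * (∑ u, r u p.2))) := by
  have h1 : ∀ p : U × V, r p.1 p.2 * (Real.log (r p.1 p.2) -
      Real.log ((∑ v, r p.1 v) * (∑ u, r u p.2))) = - Real.negMulLog (r p.1 p.2) -
      r p.1 p.2 * Real.log (∑ v, r p.1 v) - r p.1 p.2 * Real.log (∑ u, r u p.2) := by
    intro p
    by_cases h : r p.1 p.2 = 0
    · simp [h]
    · have hp : 0 < r p.1 p.2 := lt_of_le_of_ne (hr _ _) (Ne.symm h)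
      have e1 : 0 < ∑ v, r p.1 v :=
        hp.trans_le (Finset.single_le_sum (f := fun v => r p.1 v) (fun v _ => hr _ _)
          (Finset.mem_univ p.2))
      have e2 : 0 < ∑ u, r u p.2 :=
        hp.trans_le (Finset.single_le_sum (f := fun u => r u p.2) (fun v _ => hr _ _)
          (Finset.mem_univ p.1))
      rw [Real.log_mul e1.ne' e2.ne', Real.negMulLog]; ring
  rw [Finset.sum_congr rfl fun p _ => h1 p, Finset.sum_sub_distrib, Finset.sum_sub_distrib,
    Finset.sum_neg_distrib]
  have h2 : ∑ p : U × V, r p.1 p.2 * Real.log (∑ v, r p.1 v) = - Hn (fun u => ∑ v, r u v) := by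
    rw [Fintype.sum_prod_type, Hn, ← Finset.sum_neg_distrib]
    refine Finset.sum_congr rfl fun u _ => ?_
    simp only [Real.negMulLog]; rw [← Finset.sum_mul]; ring
  have h3 : ∑ p : U × V, r p.1 p.2 * Real.log (∑ u, r u p.2) = - Hn (fun v => ∑ u, r u v) := by
    rw [Fintype.sum_prod_type_right, Hn, ← Finset.sum_neg_distrib]
    refine Finset.sum_congr rfl fun u _ => ?_
    simp only [Real.negMulLog]; rw [← Finset.sum_mul]; ring
  rw [h2, h3, MI]
  simp only [Hn]; ring

theorem MI_coarsen {U V A B : Type*} [Fintype U] [Fintype V] [Fintype A] [Fintype B]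
    [DecidableEq A] [DecidableEq B] (r : U → V → ℝ) (hr : ∀ u v, 0 ≤ r u v)
    (f : U → A) (g : V → B) (R : A → B → ℝ)
    (hR : ∀ a b, R a b = ∑ u, ∑ v, if f u = a ∧ g v = b then r u v else 0) :
    MI R ≤ MI r := by
  have hR0 : ∀ a b, 0 ≤ R a b := by
    intro a b; rw [hR]
    refine Finset.sum_nonneg fun u _ => Finset.sum_nonneg fun v _ => ?_
    split_ifs
    · exact hr u v
    · exact le_rfl
  have hR1 : ∀ a, ∑ b, R a b = ∑ u, if f u = a then ∑ v, r u v else 0 := by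
    intro a
    simp only [hR]
    rw [Finset.sum_comm]
    refine Finset.sum_congr rfl fun u _ => ?_
    rw [Finset.sum_comm]
    by_cases h : f u = a <;> simp [h]
  have hR2 : ∀ b, ∑ a, R a b = ∑ v, if g v = b then ∑ u, r u v else 0 := by
    intro b
    simp only [hR]
    rw [Finset.sum_comm]
    have : ∀ u, ∑ a, ∑ v, (if f u = a ∧ g v = b then r u v else 0) =
        ∑ v, if g v = b then r u v else 0 := by
      intro u
      rw [Finset.sum_comm]
      refine Finset.sum_congr rfl fun v _ => ?_
      by_cases h : g v = b <;> simp [h]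
    simp only [this]
    rw [Finset.sum_comm]
    refine Finset.sum_congr rfl fun v _ => ?_
    by_cases h : g v = b <;> simp [h]
  rw [MI_eq r hr, MI_eq R hR0]
  rw [← Finset.sum_fiberwise (s := (Finset.univ : Finset (U × V)))
    (g := fun p : U × V => (f p.1, g p.2))]
  refine Finset.sum_le_sum fun q _ => ?_
  obtain ⟨a, b⟩ := q
  have e1 : R a b = ∑ p : U × V with (f p.1, g p.2) = (a, b), r p.1 p.2 := by
    rw [hR, Finset.sum_filter, Fintype.sum_prod_type]
    simp only [Prod.mk.injEq]
  have e2 : (∑ b, R a b) * (∑ a, R a b) = ∑ p : U × V with (f p.1, g p.2) = (a, b),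
      (∑ v, r p.1 v) * (∑ u, r u p.2) := by
    rw [hR1, hR2, Finset.sum_mul_sum, Finset.sum_filter, Fintype.sum_prod_type]
    refine Finset.sum_congr rfl fun u _ => Finset.sum_congr rfl fun v _ => ?_
    by_cases h : f u = a <;> by_cases h' : g v = b <;> simp [h, h']
  simp only
  rw [e2, e1]
  refine log_sum_ineq _ _ _ (fun p _ => hr _ _) (fun p _ => mul_nonneg
    (Finset.sum_nonneg fun _ _ => hr _ _) (Finset.sum_nonneg fun _ _ => hr _ _)) ?_
  intro p _ h
  rcases mul_eq_zero.1 h with h | h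
  · exact (Finset.sum_eq_zero_iff_of_nonneg (fun _ _ => hr _ _)).1 h p.2 (Finset.mem_univ _)
  · exact (Finset.sum_eq_zero_iff_of_nonneg (fun _ _ => hr _ _)).1 h p.1 (Finset.mem_univ _)

/-- Mutual information in terms of an input vector and a stochastic kernel. -/
theorem MI_kernel {I S : Type*} [Fintype I] [Fintype S] (m : I → ℝ) (K : I → S → ℝ)
    (hK1 : ∀ i, ∑ s, K i s = 1) :
    MI (fun i s => m i * K i s) = Hn (fun s => ∑ i, m i * K i s) - ∑ i, m i * Hn (K i) := by
  have h1 : ∀ i, ∑ s, m i * K i s = m i := by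
    intro i; rw [← Finset.mul_sum, hK1, mul_one]
  have h2 : Hn (fun p : I × S => m p.1 * K p.1 p.2) = Hn m + ∑ i, m i * Hn (K i) := by
    simp only [Hn]
    rw [Fintype.sum_prod_type, ← Finset.sum_add_distrib]
    refine Finset.sum_congr rfl fun i _ => ?_
    simp only [Real.negMulLog_mul, Finset.sum_add_distrib]
    rw [← Finset.sum_mul, ← Finset.mul_sum, hK1, one_mul]
  rw [MI, h2]; simp only [h1]
  ring_nf

theorem negMulLog_add_le {x y : ℝ} (hx : 0 ≤ x) (hy : 0 ≤ y) :
    Real.negMulLog (x + y) ≤ Real.negMulLog x + Real.negMulLog y := by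
  rcases hx.eq_or_lt with h | h
  · simp [← h]
  rcases hy.eq_or_lt with h' | h'
  · simp [← h']
  simp only [Real.negMulLog]
  have h1 := Real.log_le_log h (by linarith : x ≤ x + y)
  have h2 := Real.log_le_log h' (by linarith : y ≤ x + y)
  nlinarith

theorem negMulLog_sum_le {B : Type*} (s : Finset B) (q : B → ℝ) (hq : ∀ b, 0 ≤ q b) :
    Real.negMulLog (∑ b ∈ s, q b) ≤ ∑ b ∈ s, Real.negMulLog (q b) := by
  classical
  induction s using Finset.induction_on with
  | empty => simp
  | insert a s ha ih =>
    rw [Finset.sum_insert ha, Finset.sum_insert ha]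
    exact (negMulLog_add_le (hq a) (Finset.sum_nonneg fun b _ => hq b)).trans (by linarith)

theorem Hn_sum_le {B S : Type*} [Fintype B] [Fintype S] (q : B → S → ℝ) (hq : ∀ b s, 0 ≤ q b s) :
    Hn (fun s => ∑ b, q b s) ≤ ∑ b, Hn (q b) := by
  simp only [Hn]
  rw [Finset.sum_comm]
  exact Finset.sum_le_sum fun s _ => negMulLog_sum_le _ _ fun b => hq b s

theorem Hn_smul {S : Type*} [Fintype S] (w : ℝ) (q : S → ℝ) :
    Hn (fun s => w * q s) = (∑ s, q s) * Real.negMulLog w + w * Hn q := by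
  simp only [Hn, Real.negMulLog_mul, Finset.sum_add_distrib]
  rw [← Finset.sum_mul, ← Finset.mul_sum]

/-- Marginalising a product of stochastic vectors. -/
theorem sum_pi_prod_mul {G S : Type*} [Fintype G] [DecidableEq G] [Fintype S]
    (κ : G → S → ℝ) (hκ : ∀ j, ∑ s, κ j s = 1) (j : G) (f : S → ℝ) :
    ∑ s : G → S, (∏ j, κ j (s j)) * f (s j) = ∑ t, κ j t * f t := by
  have h := Finset.prod_univ_sum (fun _ : G => (Finset.univ : Finset S))
    (fun i t => κ i t * (if i = j then f t else 1))
  rw [Fintype.piFinset_univ] at h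
  have h1 : ∀ s : G → S, ∏ i, (κ i (s i) * if i = j then f (s i) else 1) =
      (∏ j, κ j (s j)) * f (s j) := by
    intro s
    rw [Finset.prod_mul_distrib]
    simp [Finset.prod_ite_eq']
  simp only [h1] at h
  rw [← h, Finset.prod_eq_single j]
  · simp
  · intro i _ hij; simp [hij, hκ]
  · simp

theorem sum_pi_prod {G S : Type*} [Fintype G] [DecidableEq G] [Fintype S]
    (κ : G → S → ℝ) (hκ : ∀ j, ∑ s, κ j s = 1) :
    ∑ s : G → S, (∏ j, κ j (s j)) = 1 := by
  have h := Finset.prod_univ_sum (fun _ : G => (Finset.univ : Finset S)) κ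
  rw [Fintype.piFinset_univ] at h
  rw [← h]; simp [hκ]

theorem Hn_prod {G S : Type*} [Fintype G] [DecidableEq G] [Fintype S]
    (κ : G → S → ℝ) (hκ : ∀ j, ∑ s, κ j s = 1) :
    Hn (fun s : G → S => ∏ j, κ j (s j)) = ∑ j, Hn (κ j) := by
  have h1 : ∀ s : G → S, Real.negMulLog (∏ j, κ j (s j)) =
      ∑ j, (∏ j, κ j (s j)) * (- Real.log (κ j (s j))) := by
    intro s
    rw [Real.negMulLog]
    by_cases h : ∃ j, κ j (s j) = 0
    · obtain ⟨j, hj⟩ := h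
      have : ∏ j, κ j (s j) = 0 := Finset.prod_eq_zero (Finset.mem_univ j) hj
      simp [this]
    · push Not at h
      rw [Real.log_prod (fun j _ => h j), Finset.mul_sum]
      refine Finset.sum_congr rfl fun j _ => by ring
  simp only [Hn, h1]
  rw [Finset.sum_comm]
  refine Finset.sum_congr rfl fun j _ => ?_
  rw [sum_pi_prod_mul κ hκ j (fun t => - Real.log (κ j t))]
  refine Finset.sum_congr rfl fun t _ => ?_
  rw [Real.negMulLog]; ring

/-- Subadditivity of entropy. `qj` are the marginals of `q`. -/
theorem Hn_subadd {G S : Type*} [Fintype G] [DecidableEq G] [Fintype S]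
    (q : (G → S) → ℝ) (hq : ∀ s, 0 ≤ q s) (hq1 : ∑ s, q s = 1) (qj : G → S → ℝ)
    (hqj0 : ∀ j t, 0 ≤ qj j t)
    (hqj : ∀ j (f : S → ℝ), ∑ s, q s * f (s j) = ∑ t, qj j t * f t) :
    Hn q ≤ ∑ j, Hn (qj j) := by
  classical
  have hqj1 : ∀ j, ∑ t, qj j t = 1 := by
    intro j
    have := hqj j (fun _ => 1)
    simp only [mul_one] at this; rw [← this, hq1]
  have hpos : ∀ s, q s ≠ 0 → ∀ j, qj j (s j) ≠ 0 := by
    intro s hs j h0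
    have := hqj j (fun t => if t = s j then 1 else 0)
    simp only [mul_ite, mul_one, mul_zero, Finset.sum_ite_eq', Finset.mem_univ, if_true] at this
    rw [h0] at this
    have h2 := (Finset.sum_eq_zero_iff_of_nonneg (fun s' _ => by
      split_ifs
      · exact hq s'
      · exact le_rfl)).1 this s (Finset.mem_univ s)
    simp at h2; exact hs h2
  have h := log_sum_ineq Finset.univ q (fun s => ∏ j, qj j (s j)) (fun s _ => hq s)
    (fun s _ => Finset.prod_nonneg fun j _ => hqj0 _ _) (by
      intro s _ h
      by_contra hs
      exact (Finset.prod_ne_zero_iff.2 fun j _ => hpos s hs j) h)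
  rw [hq1, sum_pi_prod qj hqj1] at h
  simp only [Real.log_one, sub_zero, mul_zero] at h
  have h3 : ∀ s, q s * (Real.log (q s) - Real.log (∏ j, qj j (s j))) =
      ∑ j, q s * (- Real.log (qj j (s j))) - Real.negMulLog (q s) := by
    intro s
    by_cases hs : q s = 0
    · simp [hs]
    · rw [Real.log_prod (fun j _ => hpos s hs j), Real.negMulLog, ← Finset.mul_sum,
        Finset.sum_neg_distrib]; ring
  simp only [h3] at h
  rw [Finset.sum_sub_distrib, Finset.sum_comm] at h
  have h4 : ∀ j, ∑ s, q s * (- Real.log (qj j (s j))) = Hn (qj j) := by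
    intro j
    rw [hqj j (fun t => - Real.log (qj j t)), Hn]
    refine Finset.sum_congr rfl fun t _ => by rw [Real.negMulLog]; ring
  simp only [h4] at h
  simp only [Hn] at h ⊢
  linarith

/-- Homogeneous mutual information of an unnormalised input `m` through the kernel `K`. -/
def Iu {I S : Type*} [Fintype I] [Fintype S] (m : I → ℝ) (K : I → S → ℝ) : ℝ :=
  Hn (fun s => ∑ i, m i * K i s) - Real.negMulLog (∑ i, m i) - ∑ i, m i * Hn (K i)

theorem Iu_smul {I S : Type*} [Fintype I] [Fintype S] (w : ℝ) (p : I → ℝ) (hp : ∑ i, p i = 1)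
    (K : I → S → ℝ) (hK1 : ∀ i, ∑ s, K i s = 1) :
    Iu (fun i => w * p i) K = w * Iu p K := by
  have h1 : (fun s => ∑ i, w * p i * K i s) = fun s => w * ∑ i, p i * K i s := by
    ext s; rw [Finset.mul_sum]; exact Finset.sum_congr rfl fun i _ => by ring
  have h2 : ∑ s, ∑ i, p i * K i s = 1 := by
    rw [Finset.sum_comm]; simp only [← Finset.mul_sum, hK1, mul_one, hp]
  have h3 : ∑ i, w * p i * Hn (K i) = w * ∑ i, p i * Hn (K i) := by
    rw [Finset.mul_sum]; exact Finset.sum_congr rfl fun i _ => by ring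
  rw [Iu, Iu, h1, Hn_smul, h2, h3, ← Finset.mul_sum, hp]
  simp; ring

theorem block_bound {B G I S : Type*} [Fintype B] [Fintype G] [DecidableEq G] [Fintype I]
    [Fintype S] (M : B → (G → I) → ℝ) (hM : ∀ b i, 0 ≤ M b i) (m : B → I → ℝ)
    (hm : ∀ b i, 0 ≤ m b i)
    (hmt : ∀ b, ∑ i, M b i = ∑ i, m b i)
    (hmarg : ∀ b j (f : I → ℝ), ∑ i, M b i * f (i j) = ∑ i, m b i * f i)
    (K : B → I → S → ℝ) (hK0 : ∀ b i s, 0 ≤ K b i s) (hK1 : ∀ b i, ∑ s, K b i s = 1) :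
    Hn (fun s : G → S => ∑ b, ∑ i, M b i * ∏ j, K b (i j) (s j)) -
      ∑ b, ∑ i, M b i * Hn (fun s : G → S => ∏ j, K b (i j) (s j)) ≤
    ∑ b, Real.negMulLog (∑ i, m b i) + Fintype.card G * ∑ b, Iu (m b) (K b) := by
  have hP0 : ∀ b (i : G → I) (s : G → S), 0 ≤ ∏ j, K b (i j) (s j) := fun b i s =>
    Finset.prod_nonneg fun j _ => hK0 _ _ _
  have hq0 : ∀ b (s : G → S), 0 ≤ ∑ i, M b i * ∏ j, K b (i j) (s j) := fun b s =>
    Finset.sum_nonneg fun i _ => mul_nonneg (hM b i) (hP0 _ _ _)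
  have step1 := Hn_sum_le (fun b (s : G → S) => ∑ i, M b i * ∏ j, K b (i j) (s j)) hq0
  have step2 : ∀ b, ∑ i, M b i * Hn (fun s : G → S => ∏ j, K b (i j) (s j)) =
      Fintype.card G * ∑ i, m b i * Hn (K b i) := by
    intro b
    have : ∀ i : G → I, M b i * Hn (fun s : G → S => ∏ j, K b (i j) (s j)) =
        ∑ j, M b i * Hn (K b (i j)) := by
      intro i
      rw [Hn_prod (fun j => K b (i j)) (fun j => hK1 _ _), Finset.mul_sum]
    simp only [this]
    rw [Finset.sum_comm]
    simp only [hmarg b _ (fun i => Hn (K b i))]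
    simp
  have step3 : ∀ b, Hn (fun s : G → S => ∑ i, M b i * ∏ j, K b (i j) (s j)) ≤
      Real.negMulLog (∑ i, m b i) + Fintype.card G *
        (Hn (fun s => ∑ i, m b i * K b i s) - Real.negMulLog (∑ i, m b i)) := by
    intro b
    set w := ∑ i, m b i with hw
    have hw0 : 0 ≤ w := Finset.sum_nonneg fun i _ => hm b i
    rcases hw0.eq_or_lt with h | h
    · have h1 : ∀ i, m b i = 0 := fun i =>
        (Finset.sum_eq_zero_iff_of_nonneg fun i _ => hm b i).1 h.symm i (Finset.mem_univ i)
      have h2 : ∀ i, M b i = 0 := fun i =>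
        (Finset.sum_eq_zero_iff_of_nonneg fun i _ => hM b i).1
          ((hmt b).trans h.symm) i (Finset.mem_univ i)
      simp [← h, h1, h2, Hn]
    · set q : (G → S) → ℝ := fun s => w⁻¹ * ∑ i, M b i * ∏ j, K b (i j) (s j) with hq
      set qj : S → ℝ := fun t => w⁻¹ * ∑ i, m b i * K b i t with hqj
      have hqj1 : ∑ t, qj t = 1 := by
        simp only [hqj]
        rw [← Finset.mul_sum, Finset.sum_comm]
        simp only [← Finset.mul_sum, hK1, mul_one]
        rw [← hw]; field_simp
      have hq1 : ∑ s, q s = 1 := by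
        simp only [hq]
        rw [← Finset.mul_sum, Finset.sum_comm]
        have : ∀ i : G → I, ∑ s : G → S, M b i * ∏ j, K b (i j) (s j) = M b i := by
          intro i
          rw [← Finset.mul_sum, sum_pi_prod (fun j => K b (i j)) (fun j => hK1 _ _), mul_one]
        simp only [this]
        rw [hmt, ← hw]; field_simp
      have hs := Hn_subadd q (fun s => mul_nonneg (inv_nonneg.2 hw0) (hq0 b s)) hq1
        (fun _ => qj) (fun _ t => mul_nonneg (inv_nonneg.2 hw0)
          (Finset.sum_nonneg fun i _ => mul_nonneg (hm b i) (hK0 _ _ _))) (by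
          intro j f
          simp only [hq, hqj]
          have e1 : ∑ s : G → S, w⁻¹ * (∑ i, M b i * ∏ j, K b (i j) (s j)) * f (s j) =
              w⁻¹ * ∑ i, M b i * ∑ t, K b (i j) t * f t := by
            simp only [mul_assoc, ← Finset.mul_sum, Finset.sum_mul]
            rw [Finset.sum_comm]
            congr 1
            refine Finset.sum_congr rfl fun i _ => ?_
            rw [← Finset.mul_sum, sum_pi_prod_mul (fun j => K b (i j)) (fun j => hK1 _ _)]
          rw [e1, hmarg b j (fun i => ∑ t, K b i t * f t)]
          simp only [mul_assoc, ← Finset.mul_sum, Finset.sum_mul]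
          rw [Finset.sum_comm]
          simp only [Finset.mul_sum])
      have e2 : (fun s : G → S => ∑ i, M b i * ∏ j, K b (i j) (s j)) = fun s => w * q s := by
        ext s; simp only [hq]; field_simp
      have e3 : (fun s => ∑ i, m b i * K b i s) = fun s => w * qj s := by
        ext s; simp only [hqj]; field_simp
      rw [e2, e3, Hn_smul w q, Hn_smul w qj, hq1, hqj1]
      simp only [Finset.sum_const, Finset.card_univ, nsmul_eq_mul] at hs
      have := mul_le_mul_of_nonneg_left hs hw0
      linarith
  have : ∑ b, Iu (m b) (K b) = ∑ b, (Hn (fun s => ∑ i, m b i * K b i s) -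
      Real.negMulLog (∑ i, m b i)) - ∑ b, ∑ i, m b i * Hn (K b i) := by
    rw [← Finset.sum_sub_distrib]; rfl
  rw [this]
  simp only [step2]
  have h3 := Finset.sum_le_sum fun b (_ : b ∈ Finset.univ) => step3 b
  rw [Finset.sum_add_distrib, ← Finset.mul_sum] at h3
  rw [← Finset.mul_sum]
  linarith

theorem Iu_nonneg {I S : Type*} [Fintype I] [Fintype S] (p : I → ℝ) (hp0 : ∀ i, 0 ≤ p i)
    (hp : ∑ i, p i = 1) (K : I → S → ℝ) (hK0 : ∀ i s, 0 ≤ K i s) : 0 ≤ Iu p K := by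
  rw [Iu, hp, Real.negMulLog_one, sub_zero, sub_nonneg]
  simp only [Hn, Finset.mul_sum]
  rw [Finset.sum_comm]
  refine Finset.sum_le_sum fun s _ => ?_
  have := Real.concaveOn_negMulLog.le_map_sum (t := Finset.univ) (w := p) (p := fun i => K i s)
    (fun i _ => hp0 i) hp (fun i _ => hK0 i s)
  simpa [smul_eq_mul] using this

theorem Hn_nonneg {S : Type*} [Fintype S] (q : S → ℝ) (hq : ∀ s, 0 ≤ q s) (hq1 : ∑ s, q s = 1) :
    0 ≤ Hn q := by
  refine Finset.sum_nonneg fun s _ => Real.negMulLog_nonneg (hq s) ?_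
  rw [← hq1]; exact Finset.single_le_sum (fun s _ => hq s) (Finset.mem_univ s)

theorem Hn_le_log {S : Type*} [Fintype S] (q : S → ℝ) (hq : ∀ s, 0 ≤ q s) (hq1 : ∑ s, q s = 1) :
    Hn q ≤ Real.log (Fintype.card S) := by
  have h := log_sum_ineq Finset.univ q (fun _ => 1) (fun s _ => hq s) (by simp) (by simp)
  rw [hq1] at h
  simp only [Real.log_one, sub_zero, Finset.sum_const, Finset.card_univ, nsmul_eq_mul, mul_one,
    one_mul, zero_sub] at h
  have : Hn q = - ∑ i, q i * Real.log (q i) := by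
    rw [Hn, ← Finset.sum_neg_distrib]
    exact Finset.sum_congr rfl fun s _ => by rw [Real.negMulLog]; ring
  linarith

/-- Uniform continuity of the mutual information in the input distribution. -/
theorem Iu_unif_cont {N : ℕ} (δ : ℝ) (hδ : 0 < δ) : ∃ κ > 0, ∀ (p p' : Fin N → ℝ)
    (K : Fin N → Fin N → ℝ), (∀ i, 0 ≤ p i) → ∑ i, p i = 1 → (∀ i, 0 ≤ p' i) → ∑ i, p' i = 1 →
    (∀ i s, 0 ≤ K i s) → (∀ i, ∑ s, K i s = 1) → (∀ i, |p i - p' i| ≤ κ) →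
    Iu p K ≤ Iu p' K + δ := by
  have huc := isCompact_Icc.uniformContinuousOn_of_continuous
    (f := Real.negMulLog) (s := Set.Icc (0 : ℝ) 1) Real.continuous_negMulLog.continuousOn
  rw [Metric.uniformContinuousOn_iff] at huc
  obtain ⟨τ, hτ, h⟩ := huc (δ / (2 * (N + 1))) (by positivity)
  set C : ℝ := Real.log N + 1 with hC
  have hlog : 0 ≤ Real.log N := Real.log_natCast_nonneg N
  have hC0 : C ≠ 0 := by rw [hC]; positivity
  refine ⟨min (τ / (2 * (N + 1))) (δ / (2 * (N + 1) * C)), by positivity, ?_⟩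
  intro p p' K hp hp1 hp' hp1' hK0 hK1 hpp
  have hKle : ∀ i s, K i s ≤ 1 := fun i s => by
    rw [← hK1 i]; exact Finset.single_le_sum (fun s _ => hK0 i s) (Finset.mem_univ s)
  have hqmem : ∀ (p : Fin N → ℝ), (∀ i, 0 ≤ p i) → ∑ i, p i = 1 → ∀ s,
      ∑ i, p i * K i s ∈ Set.Icc (0 : ℝ) 1 := by
    intro p hp hp1 s
    refine ⟨Finset.sum_nonneg fun i _ => mul_nonneg (hp i) (hK0 _ _), ?_⟩
    rw [← hp1]
    exact Finset.sum_le_sum fun i _ => mul_le_of_le_one_right (hp i) (hKle i s)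
  have hN : (N : ℝ) < 2 * (N + 1) := by
    have : (0 : ℝ) ≤ N := Nat.cast_nonneg N
    linarith
  have h1 : ∀ s, |Real.negMulLog (∑ i, p i * K i s) - Real.negMulLog (∑ i, p' i * K i s)| ≤
      δ / (2 * (N + 1)) := by
    intro s
    refine (h _ (hqmem p hp hp1 s) _ (hqmem p' hp' hp1' s) ?_).le
    rw [Real.dist_eq, ← Finset.sum_sub_distrib]
    calc |∑ i, (p i * K i s - p' i * K i s)| ≤ ∑ i, |p i * K i s - p' i * K i s| :=
          Finset.abs_sum_le_sum_abs _ _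
      _ ≤ ∑ i : Fin N, τ / (2 * (N + 1)) := by
          refine Finset.sum_le_sum fun i _ => ?_
          rw [← sub_mul, abs_mul, abs_of_nonneg (hK0 i s)]
          calc _ ≤ |p i - p' i| * 1 := by gcongr; exact hKle i s
            _ ≤ _ := by rw [mul_one]; exact (hpp i).trans (min_le_left _ _)
      _ = N * (τ / (2 * (N + 1))) := by simp
      _ < τ := by
          rw [mul_div_assoc', div_lt_iff₀ (by positivity)]
          nlinarith
  have h2 : Hn (fun s => ∑ i, p i * K i s) - Hn (fun s => ∑ i, p' i * K i s) ≤ δ / 2 := by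
    simp only [Hn]
    rw [← Finset.sum_sub_distrib]
    calc _ ≤ ∑ s : Fin N, δ / (2 * (N + 1)) :=
          Finset.sum_le_sum fun s _ => (le_abs_self _).trans (h1 s)
      _ = N * (δ / (2 * (N + 1))) := by simp
      _ ≤ δ / 2 := by
          rw [mul_div_assoc', div_le_div_iff₀ (by positivity) (by positivity)]
          nlinarith
  have h3 : ∑ i, p' i * Hn (K i) - ∑ i, p i * Hn (K i) ≤ δ / 2 := by
    rw [← Finset.sum_sub_distrib]
    calc _ ≤ ∑ i : Fin N, δ / (2 * (N + 1)) := by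
          refine Finset.sum_le_sum fun i _ => ?_
          have e1 := Hn_nonneg (K i) (hK0 i) (hK1 i)
          have e2 : Hn (K i) ≤ C := (Hn_le_log (K i) (hK0 i) (hK1 i)).trans (by simp [hC])
          rw [← sub_mul]
          have e3 : |p' i - p i| ≤ δ / (2 * (N + 1) * C) := by
            rw [abs_sub_comm]; exact (hpp i).trans (min_le_right _ _)
          calc (p' i - p i) * Hn (K i) ≤ |p' i - p i| * Hn (K i) := by
                gcongr; exact le_abs_self _
            _ ≤ (δ / (2 * (N + 1) * C)) * C := by gcongr
            _ = _ := by field_simp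
      _ = N * (δ / (2 * (N + 1))) := by simp
      _ ≤ δ / 2 := by
          rw [mul_div_assoc', div_le_div_iff₀ (by positivity) (by positivity)]
          nlinarith
  rw [Iu, Iu, hp1, hp1']
  linarith

end

end RDB

open MeasureTheory Filter Set
open scoped ENNReal Topology NNReal

set_option linter.unusedSectionVars false

namespace RDB

noncomputable section

theorem shannonEntropy_eq {Ω S : Type*} [MeasurableSpace Ω] [Fintype S] (P : Measure Ω)
    (f : Ω → S) :
    shannonEntropy P f = Hn (fun i => (P (f ⁻¹' {i})).toReal) / Real.log 2 := by
  rw [shannonEntropy, Hn, ← Finset.sum_neg_distrib, Finset.sum_div]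
  refine Finset.sum_congr rfl fun i _ => ?_
  rw [Real.negMulLog, Real.logb]; ring

theorem toReal_sum_fiber {Ω A B : Type*} [MeasurableSpace Ω] [Fintype B]
    [MeasurableSpace A] [MeasurableSingletonClass A]
    [MeasurableSpace B] [MeasurableSingletonClass B]
    (P : Measure Ω) [IsFiniteMeasure P] (U : Ω → A) (V : Ω → B) (hU : Measurable U)
    (hV : Measurable V) (a : A) :
    (P (U ⁻¹' {a})).toReal = ∑ b, (P ((fun ω => (U ω, V ω)) ⁻¹' {(a, b)})).toReal := by
  rw [← ENNReal.toReal_sum (fun b _ => measure_ne_top _ _)]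
  congr 1
  have : U ⁻¹' {a} = ⋃ b ∈ (Finset.univ : Finset B), (fun ω => (U ω, V ω)) ⁻¹' {(a, b)} := by
    ext ω; simp
  rw [this, measure_biUnion_finset]
  · intro b _ b' _ hbb
    rw [Function.onFun, Set.disjoint_left]
    intro ω h h'
    simp only [mem_preimage, mem_singleton_iff, Prod.mk.injEq] at h h'
    exact hbb (h.2.symm.trans h'.2)
  · intro b _
    exact (hU.prodMk hV) (measurableSet_singleton _)

theorem toReal_sum_fiber' {Ω A B : Type*} [MeasurableSpace Ω] [Fintype A]
    [MeasurableSpace A] [MeasurableSingletonClass A]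
    [MeasurableSpace B] [MeasurableSingletonClass B]
    (P : Measure Ω) [IsFiniteMeasure P] (U : Ω → A) (V : Ω → B) (hU : Measurable U)
    (hV : Measurable V) (b : B) :
    (P (V ⁻¹' {b})).toReal = ∑ a, (P ((fun ω => (U ω, V ω)) ⁻¹' {(a, b)})).toReal := by
  rw [toReal_sum_fiber P V U hV hU b]
  refine Finset.sum_congr rfl fun a _ => ?_
  congr 2
  ext ω; simp [and_comm]

theorem shannon_MI {Ω : Type*} {n m : ℕ} [MeasurableSpace Ω]
    (P : Measure Ω) [IsFiniteMeasure P] (U : Ω → Fin n) (V : Ω → Fin m) (hU : Measurable U)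
    (hV : Measurable V) :
    shannonEntropy P U + shannonEntropy P V - shannonEntropy P (fun ω => (U ω, V ω)) =
      MI (fun a b => (P ((fun ω => (U ω, V ω)) ⁻¹' {(a, b)})).toReal) / Real.log 2 := by
  rw [shannonEntropy_eq, shannonEntropy_eq, shannonEntropy_eq, MI]
  simp only [toReal_sum_fiber P U V hU hV, toReal_sum_fiber' P U V hU hV]
  ring

theorem measurableSet_unitBox (d : ℕ) (L : ℝ) : MeasurableSet (unitBox d L) :=
  MeasurableSet.univ_pi fun _ => measurableSet_Ico

theorem volume_unitBox (d : ℕ) (L : ℝ) : volume (unitBox d L) = ENNReal.ofReal L ^ d := by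
  have := Real.volume_pi_Ico (a := fun _ : Fin d => (0 : ℝ)) (b := fun _ => L)
  rw [unitBox, this]; simp

instance (d : ℕ) (L : ℝ) : IsFiniteMeasure (boxMeasure d L) := by
  constructor
  rw [boxMeasure, Measure.restrict_apply_univ, volume_unitBox]
  exact ENNReal.pow_lt_top ENNReal.ofReal_lt_top

theorem boxMeasure_real (d : ℕ) (L : ℝ) (hL : 0 ≤ L) : (boxMeasure d L).real univ = L ^ d := by
  rw [Measure.real, boxMeasure, Measure.restrict_apply_univ, volume_unitBox]
  simp [ENNReal.toReal_ofReal hL]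

variable {X : Type*} [MetricSpace X] [CompactSpace X] [MeasurableSpace X] [BorelSpace X]
variable {d : ℕ} {T : (Fin d → ℝ) → X → X}

/-- Normalised `L¹` distance from the orbit of `x` to the path `f`. -/
def Dn (d : ℕ) (T : (Fin d → ℝ) → X → X) (L : ℝ) (x : X) (f : (Fin d → ℝ) → X) : ℝ :=
  (L ^ d)⁻¹ * ∫ u, dist (T u x) (f u) ∂(boxMeasure d L)

theorem dist_le_diam (x y : X) : dist x y ≤ Metric.diam (univ : Set X) :=
  Metric.dist_le_diam_of_mem isCompact_univ.isBounded (mem_univ _) (mem_univ _)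

theorem measurable_orbit (hT : IsContAction d T) (x : X) : Measurable fun u => T u x :=
  (hT.1.comp (by fun_prop : Continuous fun u : Fin d → ℝ => (u, x))).measurable

theorem integrable_dist {Ω : Type*} [MeasurableSpace Ω] (P : Measure Ω) [IsFiniteMeasure P]
    (f g : Ω → X) (hf : Measurable f) (hg : Measurable g) :
    Integrable (fun ω => dist (f ω) (g ω)) P := by
  refine Integrable.of_bound (C := Metric.diam (univ : Set X))
    (hf.dist hg).aestronglyMeasurable (Eventually.of_forall fun ω => ?_)
  rw [Real.norm_eq_abs, abs_of_nonneg dist_nonneg]; exact dist_le_diam _ _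

theorem Dn_nonneg (L : ℝ) (hL : 0 ≤ L) (x : X) (f : (Fin d → ℝ) → X) : 0 ≤ Dn d T L x f :=
  mul_nonneg (inv_nonneg.2 (pow_nonneg hL d)) (integral_nonneg fun _ => dist_nonneg)

theorem Dn_le_of_le (hT : IsContAction d T) (L : ℝ) (hL : 0 < L) (x : X) (f : (Fin d → ℝ) → X)
    (hf : Measurable f)
    (C : ℝ) (h : ∀ u ∈ unitBox d L, dist (T u x) (f u) ≤ C) : Dn d T L x f ≤ C := by
  have h1 : ∫ u, dist (T u x) (f u) ∂(boxMeasure d L) ≤ ∫ u, C ∂(boxMeasure d L) := by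
    refine integral_mono_ae (integrable_dist _ _ _ (measurable_orbit hT x) hf)
      (integrable_const C) ?_
    exact (ae_restrict_iff' (measurableSet_unitBox d L)).2 (Eventually.of_forall h)
  rw [integral_const, boxMeasure_real d L hL.le, smul_eq_mul] at h1
  have hp : 0 < L ^ d := pow_pos hL d
  rw [Dn, inv_mul_le_iff₀ hp]
  exact h1

theorem Dn_le_diam (hT : IsContAction d T) (L : ℝ) (hL : 0 < L) (x : X) (f : (Fin d → ℝ) → X)
    (hf : Measurable f) : Dn d T L x f ≤ Metric.diam (univ : Set X) :=
  Dn_le_of_le hT L hL x f hf _ fun _ _ => dist_le_diam _ _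

theorem measurable_Dn (hT : IsContAction d T) (L : ℝ) (f : (Fin d → ℝ) → X)
    (hf : Measurable f) : Measurable fun x => Dn d T L x f := by
  unfold Dn
  refine Measurable.const_mul ?_ _
  have h : StronglyMeasurable (fun p : X × (Fin d → ℝ) => dist (T p.2 p.1) (f p.2)) := by
    refine Measurable.stronglyMeasurable ?_
    refine Measurable.dist ?_ (hf.comp measurable_snd)
    exact (hT.1.comp (by fun_prop : Continuous fun p : X × (Fin d → ℝ) => (p.2, p.1))).measurable
  exact h.integral_prod_right'.measurable

/-- The class of a measurable path in `L¹`. -/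
def toL1 (L : ℝ) (f : (Fin d → ℝ) → X) (hf : Measurable f) : L1Maps d L X :=
  AEEqFun.mk f hf.aestronglyMeasurable

theorem Dn_toL1 (L : ℝ) (x : X) (f : (Fin d → ℝ) → X) (hf : Measurable f) :
    Dn d T L x (toL1 L f hf) = Dn d T L x f := by
  unfold Dn
  congr 1
  refine integral_congr_ae ?_
  filter_upwards [AEEqFun.coeFn_mk f (hf.aestronglyMeasurable (μ := boxMeasure d L))] with u hu
  rw [toL1, hu]

theorem RL_le_of_coupling (hT : IsContAction d T) (μ : Measure X) [IsProbabilityMeasure μ]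
    {I S : Type} [Fintype I] [Fintype S] (μi : I → Measure X) (hsum : ∑ i, μi i = μ)
    (K : I → S → ℝ) (hK0 : ∀ i s, 0 ≤ K i s) (hK1 : ∀ i, ∑ s, K i s = 1)
    (y : S → (Fin d → ℝ) → X) (hy : ∀ s, Measurable (y s)) (L ε : ℝ) (hL : 0 < L)
    (hD : ∑ i, ∑ s, K i s * ∫ x, Dn d T L x (y s) ∂(μi i) < ε) :
    RL d T μ L ε ≤ ENNReal.ofReal ((Hn (fun s => ∑ i, (μi i univ).toReal * K i s) -
      ∑ i, (μi i univ).toReal * Hn (K i)) / Real.log 2) := by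
  classical
  let _ : MeasurableSpace S := ⊤
  have hne : Nonempty X := by
    by_contra h
    have h1 : (univ : Set X) = ∅ := by
      ext x; exact (h ⟨x⟩).elim
    have h2 : μ univ = 1 := measure_univ
    rw [h1] at h2; simp at h2
  have hfin : ∀ i, IsFiniteMeasure (μi i) := by
    intro i
    constructor
    have : μi i univ ≤ μ univ := by
      rw [← hsum, Measure.finsetSum_apply]
      exact Finset.single_le_sum (f := fun i => μi i univ) (fun _ _ => zero_le) (Finset.mem_univ i)
    exact this.trans_lt (measure_lt_top _ _)
  obtain ⟨e, he⟩ := exists_measurableEmbedding_real X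
  obtain ⟨g, hg, hge⟩ := he.exists_measurable_extend (g := (id : X → X)) measurable_id (fun _ => hne)
  have hge' : ∀ x, g (e x) = x := fun x => congrFun hge x
  have hmap : ∀ s : S, Measurable (fun x : X => (e x, s)) := fun s => he.measurable.prodMk measurable_const
  set P : Measure (ℝ × S) := ∑ i, ∑ s, ENNReal.ofReal (K i s) • (μi i).map (fun x => (e x, s)) with hP
  have hPapp : ∀ A : Set (ℝ × S), MeasurableSet A → P A =
      ∑ i, ∑ s, ENNReal.ofReal (K i s) * μi i {x | (e x, s) ∈ A} := by
    intro A hA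
    rw [hP, Measure.finsetSum_apply]
    refine Finset.sum_congr rfl fun i _ => ?_
    rw [Measure.finsetSum_apply]
    refine Finset.sum_congr rfl fun s _ => ?_
    rw [Measure.smul_apply, Measure.map_apply (hmap s) hA]; rfl
  have hKE : ∀ i, ∑ s, ENNReal.ofReal (K i s) = 1 := by
    intro i
    rw [← ENNReal.ofReal_sum_of_nonneg (fun s _ => hK0 i s), hK1, ENNReal.ofReal_one]
  set Xv : ℝ × S → X := fun ω => g ω.1 with hXv
  have hXvm : Measurable Xv := hg.comp measurable_fst
  have hlaw : Measure.map Xv P = μ := by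
    ext A hA
    rw [Measure.map_apply hXvm hA, hPapp _ (hXvm hA), ← hsum, Measure.finsetSum_apply]
    refine Finset.sum_congr rfl fun i _ => ?_
    simp only [mem_preimage, hXv, hge']
    rw [← Finset.sum_mul, hKE, one_mul]; rfl
  have hprob : IsProbabilityMeasure P := by
    constructor
    have h2 : μ univ = 1 := measure_univ
    rw [← hlaw, Measure.map_apply hXvm MeasurableSet.univ] at h2
    simpa using h2
  set Yv : ℝ × S → L1Maps d L X := fun ω => toL1 L (y ω.2) (hy ω.2) with hYv
  have hYvm : Measurable Yv :=
    (measurable_from_top (f := fun s => toL1 L (y s) (hy s))).comp measurable_snd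
  have hdist : distortion d T L P Xv Yv < ε := by
    refine lt_of_eq_of_lt ?_ hD
    have h1 : distortion d T L P Xv Yv = ∫ ω, Dn d T L (g ω.1) (y ω.2) ∂P := by
      unfold distortion
      refine integral_congr_ae (Eventually.of_forall fun ω => ?_)
      exact Dn_toL1 L (g ω.1) (y ω.2) (hy ω.2)
    have hF : Measurable fun ω : ℝ × S => Dn d T L (g ω.1) (y ω.2) := by
      have : Measurable fun q : S × ℝ => Dn d T L (g q.2) (y q.1) :=
        measurable_from_prod_countable_right fun s => (measurable_Dn hT L (y s) (hy s)).comp hg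
      exact this.comp measurable_swap
    have hintg : ∀ (Q : Measure (ℝ × S)), IsFiniteMeasure Q →
        Integrable (fun ω : ℝ × S => Dn d T L (g ω.1) (y ω.2)) Q := by
      intro Q _
      refine Integrable.of_bound (C := Metric.diam (univ : Set X)) hF.aestronglyMeasurable
        (Eventually.of_forall fun ω => ?_)
      rw [Real.norm_eq_abs, abs_of_nonneg (Dn_nonneg L hL.le _ _)]
      exact Dn_le_diam hT L hL _ _ (hy _)
    have hfm : ∀ i s, IsFiniteMeasure (ENNReal.ofReal (K i s) • (μi i).map (fun x => (e x, s))) :=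
      fun i s => Measure.smul_finite _ ENNReal.ofReal_ne_top
    rw [h1, hP, integral_finsetSum_measure (fun i _ => hintg _ inferInstance)]
    refine Finset.sum_congr rfl fun i _ => ?_
    rw [integral_finsetSum_measure (fun s _ => hintg _ (hfm i s))]
    refine Finset.sum_congr rfl fun s _ => ?_
    rw [integral_smul_measure, integral_map (hmap s).aemeasurable hF.aestronglyMeasurable,
      ENNReal.toReal_ofReal (hK0 i s), smul_eq_mul]
    simp only [hge']
  unfold RL
  refine iInf_le_of_le (ℝ × S) ?_
  refine iInf_le_of_le inferInstance ?_
  refine iInf_le_of_le P ?_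
  refine iInf_le_of_le hprob ?_
  refine iInf_le_of_le Xv ?_
  refine iInf_le_of_le Yv ?_
  refine iInf_le_of_le hXvm ?_
  refine iInf_le_of_le hYvm ?_
  refine iInf_le_of_le hlaw ?_
  refine iInf_le_of_le hdist ?_
  unfold mutualInfo
  refine iSup_le fun n => iSup_le fun m => iSup_le fun α => iSup_le fun hα => iSup_le fun β =>
    iSup_le fun hβ => ?_
  apply ENNReal.ofReal_le_ofReal
  rw [shannon_MI P (fun ω => α (Xv ω)) (fun ω => β (Yv ω)) (hα.comp hXvm) (hβ.comp hYvm)]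
  refine div_le_div_of_nonneg_right ?_ (Real.log_nonneg (by norm_num))
  have hgen : ∀ f : I → ℝ, ∑ ai : Fin n × I, (μi ai.2 (α ⁻¹' {ai.1})).toReal * f ai.2 =
      ∑ i, (μi i univ).toReal * f i := by
    intro f
    rw [Fintype.sum_prod_type_right]
    refine Finset.sum_congr rfl fun i _ => ?_
    dsimp only
    rw [← Finset.sum_mul]
    congr 1
    have := toReal_sum_fiber' (μi i) α (fun _ => (0 : Fin 1)) hα measurable_const 0
    simp only [mem_singleton_iff, Set.preimage_const_of_mem] at this
    rw [this]
    refine Finset.sum_congr rfl fun a _ => ?_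
    congr 2
    ext x; simp
  have hmain := hgen (fun i => Hn (K i))
  have hmain2 := fun s => hgen (fun i => K i s)
  have hk := MI_kernel (fun ai : Fin n × I => (μi ai.2 (α ⁻¹' {ai.1})).toReal)
    (fun ai s => K ai.2 s) (fun ai => hK1 ai.2)
  rw [hmain] at hk
  simp only [hmain2] at hk
  rw [← hk]
  refine MI_coarsen _ (fun ai s => mul_nonneg ENNReal.toReal_nonneg (hK0 _ _)) (fun ai => ai.1)
    (fun s => β (toL1 L (y s) (hy s))) _ ?_
  intro a b
  have hms : MeasurableSet ((fun ω => (α (Xv ω), β (Yv ω))) ⁻¹' {(a, b)}) :=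
    ((hα.comp hXvm).prodMk (hβ.comp hYvm)) (measurableSet_singleton _)
  rw [hPapp _ hms, ENNReal.toReal_sum (fun i _ => by
    refine (ENNReal.sum_lt_top.2 fun s _ => ?_).ne
    exact ENNReal.mul_lt_top ENNReal.ofReal_lt_top (measure_lt_top _ _))]
  rw [Fintype.sum_prod_type, Finset.sum_comm]
  refine Finset.sum_congr rfl fun i _ => ?_
  rw [ENNReal.toReal_sum (fun s _ =>
    (ENNReal.mul_lt_top ENNReal.ofReal_lt_top (measure_lt_top _ _)).ne), Finset.sum_comm]
  refine Finset.sum_congr rfl fun s _ => ?_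
  rw [ENNReal.toReal_mul, ENNReal.toReal_ofReal (hK0 i s)]
  simp only [mem_preimage, hXv, hYv, hge', mem_singleton_iff, Prod.mk.injEq]
  by_cases hb : β (toL1 L (y s) (hy s)) = b
  · simp only [hb, and_true, Finset.sum_ite_eq', Finset.mem_univ, if_true]
    rw [mul_comm]; rfl
  · simp [hb]

end

end RDB

open MeasureTheory Filter Set
open scoped ENNReal Topology NNReal
set_option linter.unusedSectionVars false

namespace RDB

noncomputable section

theorem measurable_choice {Y : Type*} [MeasurableSpace Y] {N : ℕ} (p : Y → Fin N → Prop)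
    (hp : ∀ y, ∃ i, p y i) (hm : ∀ i, MeasurableSet {y | p y i}) :
    ∃ c : Y → Fin N, Measurable c ∧ ∀ y, p y (c y) := by
  classical
  have hex : ∀ y, ∃ k : ℕ, ∃ h : k < N, p y ⟨k, h⟩ := fun y => by
    obtain ⟨i, hi⟩ := hp y
    exact ⟨i, i.2, hi⟩
  have hmf : Measurable fun y => Nat.find (hex y) := by
    refine measurable_find hex fun k => ?_
    by_cases h : k < N
    · simpa [h] using hm ⟨k, h⟩
    · simp [h]
  refine ⟨fun y => ⟨Nat.find (hex y), (Nat.find_spec (hex y)).1⟩, ?_, fun y =>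
    (Nat.find_spec (hex y)).2⟩
  refine measurable_to_countable' fun i => ?_
  have : (fun y => (⟨Nat.find (hex y), (Nat.find_spec (hex y)).1⟩ : Fin N)) ⁻¹' {i} =
      (fun y => Nat.find (hex y)) ⁻¹' {(i : ℕ)} := by
    ext y; simp [Fin.ext_iff]
  rw [this]
  exact hmf (measurableSet_singleton _)

theorem integral_finite_comp {Ω V : Type*} [MeasurableSpace Ω] [Fintype V] [MeasurableSpace V]
    [MeasurableSingletonClass V] (P : Measure Ω) [IsFiniteMeasure P] (f : Ω → V)
    (hf : Measurable f) (g : V → ℝ) :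
    ∫ ω, g (f ω) ∂P = ∑ v, (P (f ⁻¹' {v})).toReal * g v := by
  have hg : Measurable g := measurable_of_finite g
  rw [← integral_map (f := g) hf.aemeasurable hg.aestronglyMeasurable, integral_fintype]
  · refine Finset.sum_congr rfl fun v _ => ?_
    rw [Measure.real, Measure.map_apply hf (measurableSet_singleton v), smul_eq_mul]
  exact Integrable.of_finite

theorem sum_restrict_fiber {Ω V : Type*} [MeasurableSpace Ω] [Fintype V] [MeasurableSpace V]
    [MeasurableSingletonClass V] (P : Measure Ω) (f : Ω → V)
    (hf : Measurable f) : ∑ v, P.restrict (f ⁻¹' {v}) = P := by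
  ext A hA
  rw [Measure.finsetSum_apply]
  simp only [Measure.restrict_apply hA]
  have : A = ⋃ v ∈ (Finset.univ : Finset V), A ∩ f ⁻¹' {v} := by ext ω; simp
  conv_rhs => rw [this]
  rw [measure_biUnion_finset]
  · intro b _ b' _ hbb
    rw [Function.onFun, Set.disjoint_left]
    rintro ω ⟨_, h⟩ ⟨_, h'⟩
    simp only [mem_preimage, mem_singleton_iff] at h h'
    exact hbb (h.symm.trans h')
  · intro b _
    exact hA.inter (hf (measurableSet_singleton _))

variable {X : Type*} [MetricSpace X] [CompactSpace X] [MeasurableSpace X] [BorelSpace X]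
variable {d : ℕ} {T : (Fin d → ℝ) → X → X}

theorem exists_cover (hT : IsContAction d T) (L ε : ℝ) (hε : 0 < ε) :
    {n : ℕ | ∃ F : Finset (Set X), F.card = n ∧
    (∀ U ∈ F, IsOpen U ∧ (⨆ x ∈ U, ⨆ y ∈ U, ENNReal.ofReal (dSup d T L x y)) < ENNReal.ofReal ε) ∧
    ⋃₀ (F : Set (Set X)) = Set.univ}.Nonempty := by
  classical
  let Q : Set (Fin d → ℝ) := Set.Icc 0 (fun _ => L)
  have hQc : CompactSpace Q := isCompact_iff_compactSpace.1 isCompact_Icc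
  let f : C(X × Q, X) := ⟨fun p => T p.2 p.1, hT.1.comp
    (by fun_prop : Continuous fun p : X × Q => ((p.2 : Fin d → ℝ), p.1))⟩
  let U : X → Set X := fun x => f.curry ⁻¹' Metric.ball (f.curry x) (ε / 4)
  have hUo : ∀ x, IsOpen (U x) := fun x => Metric.isOpen_ball.preimage f.curry.continuous
  obtain ⟨t, ht⟩ := isCompact_univ.elim_finite_subcover U hUo (fun x _ => mem_iUnion.2 ⟨x, by
    simp [U, hε]⟩)
  refine ⟨(t.image U).card, t.image U, rfl, ?_, ?_⟩
  · intro V hV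
    obtain ⟨x, _, rfl⟩ := Finset.mem_image.1 hV
    refine ⟨hUo x, lt_of_le_of_lt (b := ENNReal.ofReal (ε / 2)) ?_
      ((ENNReal.ofReal_lt_ofReal_iff hε).2 (by linarith))⟩
    refine iSup₂_le fun y hy => iSup₂_le fun z hz => ENNReal.ofReal_le_ofReal ?_
    refine Real.iSup_le (fun u => ?_) (by linarith)
    have hu : (u : Fin d → ℝ) ∈ Q :=
      ⟨fun i => (u.2 i (mem_univ i)).1, fun i => (u.2 i (mem_univ i)).2.le⟩
    have h1 : dist (f.curry y) (f.curry z) ≤ ε / 2 := by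
      have e1 : dist (f.curry y) (f.curry x) < ε / 4 := hy
      have e2 : dist (f.curry z) (f.curry x) < ε / 4 := hz
      have := dist_triangle_right (f.curry y) (f.curry z) (f.curry x)
      linarith
    exact (ContinuousMap.dist_apply_le_dist (f := f.curry y) (g := f.curry z) ⟨u, hu⟩).trans h1
  · rw [eq_univ_iff_forall]
    intro y
    obtain ⟨x, hx, hy⟩ := mem_iUnion₂.1 (ht (mem_univ y))
    exact ⟨U x, Finset.mem_coe.2 (Finset.mem_image_of_mem U hx), hy⟩

theorem exists_cells [Nonempty X] (hT : IsContAction d T) (L ε : ℝ) (hε : 0 < ε) :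
    ∃ c : X → Fin (covNum X (dSup d T L) ε), Measurable c ∧
      ∃ x : Fin (covNum X (dSup d T L) ε) → X,
        ∀ y, ∀ u ∈ unitBox d L, dist (T u y) (T u (x (c y))) ≤ ε := by
  classical
  obtain ⟨F, hF, hF1, hF2⟩ := Nat.sInf_mem (exists_cover hT L ε hε)
  change F.card = covNum X (dSup d T L) ε at hF
  let φ : Fin (covNum X (dSup d T L) ε) ≃ F := (finCongr hF.symm).trans F.equivFin.symm
  obtain ⟨c, hc, hc1⟩ := measurable_choice (fun y i => y ∈ (φ i : Set X)) (fun y => by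
    have : y ∈ ⋃₀ (F : Set (Set X)) := by rw [hF2]; trivial
    obtain ⟨U, hU, hy⟩ := this
    exact ⟨φ.symm ⟨U, hU⟩, by simpa using hy⟩) (fun i => (hF1 _ (φ i).2).1.measurableSet)
  refine ⟨c, hc, fun i => if h : (φ i : Set X).Nonempty then h.some else Classical.arbitrary X, ?_⟩
  intro y u hu
  have hne : (φ (c y) : Set X).Nonempty := ⟨y, hc1 y⟩
  beta_reduce
  rw [dif_pos hne]
  set z := hne.some
  have hz : z ∈ (φ (c y) : Set X) := hne.some_mem
  have h1 := (hF1 _ (φ (c y)).2).2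
  have h2 : ENNReal.ofReal (dSup d T L y z) < ENNReal.ofReal ε := by
    refine lt_of_le_of_lt ?_ h1
    exact le_iSup₂_of_le y (hc1 y) (le_iSup₂_of_le z hz le_rfl)
  have h3 : dSup d T L y z < ε := (ENNReal.ofReal_lt_ofReal_iff hε).1 h2
  refine le_trans ?_ h3.le
  exact le_ciSup (f := fun u : unitBox d L => dist (T u.1 y) (T u.1 z))
    ⟨Metric.diam (univ : Set X), by rintro _ ⟨u, rfl⟩; exact dist_le_diam _ _⟩ ⟨u, hu⟩

/-- Covering bound for the rate distortion function. -/
theorem RL_le_covNum (hT : IsContAction d T) (ν : Measure X) [IsProbabilityMeasure ν]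
    (L ε : ℝ) (hL : 0 < L) (hε : 0 < ε) :
    RL d T ν L (2 * ε) ≤ ENNReal.ofReal (Real.logb 2 (covNum X (dSup d T L) ε)) := by
  have : Nonempty X := ν.nonempty_of_neZero
  obtain ⟨c, hc, x, hx⟩ := exists_cells hT L ε hε
  have key := RL_le_of_coupling hT ν (fun i => ν.restrict (c ⁻¹' {i})) (sum_restrict_fiber ν c hc)
    (fun i s => if i = s then 1 else 0) (fun i s => by split_ifs <;> norm_num) (by simp)
    (fun s u => T u (x s)) (fun s => measurable_orbit hT _) L (2 * ε) hL (by
      have h1 : ∀ i, ∑ s, (if i = s then (1 : ℝ) else 0) *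
          ∫ y, Dn d T L y (fun u => T u (x s)) ∂(ν.restrict (c ⁻¹' {i})) ≤
          (ν (c ⁻¹' {i})).toReal * ε := by
        intro i
        simp only [ite_mul, one_mul, zero_mul, Finset.sum_ite_eq, Finset.mem_univ, if_true]
        have h2 : ∫ y in c ⁻¹' {i}, Dn d T L y (fun u => T u (x i)) ∂ν ≤
            ∫ y in c ⁻¹' {i}, ε ∂ν := by
          refine integral_mono_of_nonneg (Eventually.of_forall fun y => Dn_nonneg L hL.le _ _)
            (integrable_const _) ?_
          refine (ae_restrict_iff' (hc (measurableSet_singleton i))).2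
            (Eventually.of_forall fun y hy => ?_)
          refine Dn_le_of_le hT L hL _ _ (measurable_orbit hT _) _ fun u hu => ?_
          have := hx y u hu
          rwa [show c y = i from hy] at this
        rw [integral_const, smul_eq_mul] at h2
        simpa [Measure.real] using h2
      refine lt_of_le_of_lt (Finset.sum_le_sum fun i _ => h1 i) ?_
      have h3 := integral_finite_comp ν c hc (fun _ => ε)
      rw [← h3]; simp; linarith)
  refine key.trans (ENNReal.ofReal_le_ofReal ?_)
  rw [Real.logb]
  refine div_le_div_of_nonneg_right ?_ (Real.log_nonneg (by norm_num))
  have hz : ∀ i : Fin (covNum X (dSup d T L) ε),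
      Hn (fun s => if i = s then (1 : ℝ) else 0) = 0 := by
    intro i
    refine Finset.sum_eq_zero fun s _ => ?_
    dsimp only
    split_ifs <;> simp
  simp only [hz, mul_zero, Finset.sum_const_zero, sub_zero]
  refine (Hn_le_log _ ?_ ?_).trans (by simp)
  · intro s
    refine Finset.sum_nonneg fun i _ => mul_nonneg ENNReal.toReal_nonneg ?_
    split_ifs <;> norm_num
  · have h3 := integral_finite_comp ν c hc (fun _ => (1 : ℝ))
    simp only [integral_const, smul_eq_mul, mul_one, probReal_univ] at h3
    refine Eq.trans ?_ h3.symm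
    simp

/-- Normalised `L¹` pseudo-distance between paths. -/
def Dd (d : ℕ) (L : ℝ) (f g : (Fin d → ℝ) → X) : ℝ :=
  (L ^ d)⁻¹ * ∫ u, dist (f u) (g u) ∂(boxMeasure d L)

theorem Dd_triangle (L : ℝ) (hL : 0 < L) (f g h : (Fin d → ℝ) → X) (hf : Measurable f)
    (hg : Measurable g) (hh : Measurable h) : Dd d L f h ≤ Dd d L f g + Dd d L g h := by
  unfold Dd
  rw [← mul_add, ← integral_add (integrable_dist _ _ _ hf hg) (integrable_dist _ _ _ hg hh)]
  refine mul_le_mul_of_nonneg_left ?_ (inv_nonneg.2 (pow_nonneg hL.le d))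
  exact integral_mono (integrable_dist _ _ _ hf hh)
    ((integrable_dist _ _ _ hf hg).add (integrable_dist _ _ _ hg hh))
    fun u => dist_triangle _ _ _

theorem Dd_comm (L : ℝ) (f g : (Fin d → ℝ) → X) : Dd d L f g = Dd d L g f := by
  unfold Dd; simp only [dist_comm]

theorem measurable_coeFn_L1 (L : ℝ) (g : L1Maps d L X) : Measurable (g : (Fin d → ℝ) → X) :=
  (AEEqFun.stronglyMeasurable g).measurable

theorem measurable_Dn_L1 (hT : IsContAction d T) (L : ℝ) (x : X) :
    Measurable fun g : L1Maps d L X => Dn d T L x g := by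
  have h : Measurable fun g : L1Maps d L X => L1dist (toL1 L (fun u => T u x)
      (measurable_orbit hT x)) g := by
    refine measurable_of_Iio fun r => ?_
    exact MeasurableSpace.measurableSet_generateFrom ⟨_, r, rfl⟩
  have h2 : (fun g : L1Maps d L X => Dn d T L x g) = fun g => (L ^ d)⁻¹ * L1dist (toL1 L
      (fun u => T u x) (measurable_orbit hT x)) g := by
    ext g
    unfold Dn L1dist
    congr 1
    refine integral_congr_ae ?_
    filter_upwards [AEEqFun.coeFn_mk (fun u => T u x)
      ((measurable_orbit hT x).aestronglyMeasurable (μ := boxMeasure d L))] with u hu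
    rw [toL1, hu]
  rw [h2]
  exact h.const_mul _

theorem measurable_Dn_pair [Nonempty X] (hT : IsContAction d T) (L : ℝ) (hL : 0 < L) {Ω : Type*}
    [MeasurableSpace Ω] (Xv : Ω → X) (Yv : Ω → L1Maps d L X) (hX : Measurable Xv)
    (hY : Measurable Yv) : Measurable fun ω => Dn d T L (Xv ω) (Yv ω) := by
  choose c hc x hx using fun n : ℕ => exists_cells hT L (1 / ((n : ℝ) + 1)) (by positivity)
  refine measurable_of_tendsto_metrizable (f := fun n ω => Dn d T L (x n (c n (Xv ω))) (Yv ω)) ?_ ?_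
  · intro n
    have : Measurable fun q : Fin (covNum X (dSup d T L) (1 / ((n : ℝ) + 1))) × L1Maps d L X =>
        Dn d T L (x n q.1) q.2 :=
      measurable_from_prod_countable_right fun i => measurable_Dn_L1 hT L (x n i)
    exact this.comp (((hc n).comp hX).prodMk hY)
  · rw [tendsto_pi_nhds]
    intro ω
    rw [tendsto_iff_dist_tendsto_zero]
    refine squeeze_zero (fun _ => dist_nonneg) (fun n => ?_) tendsto_one_div_add_atTop_nhds_zero_nat
    have h1 : Dd d L (fun u => T u (Xv ω)) (fun u => T u (x n (c n (Xv ω)))) ≤ 1 / ((n : ℝ) + 1) :=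
      Dn_le_of_le hT L hL (Xv ω) _ (measurable_orbit hT _) _ (hx n (Xv ω))
    have h2 := Dd_triangle L hL _ _ _ (measurable_orbit hT (Xv ω))
      (measurable_orbit hT (x n (c n (Xv ω)))) (measurable_coeFn_L1 L (Yv ω))
    have h3 := Dd_triangle L hL _ _ _ (measurable_orbit hT (x n (c n (Xv ω))))
      (measurable_orbit hT (Xv ω)) (measurable_coeFn_L1 L (Yv ω))
    rw [Dd_comm L (fun u => T u (x n (c n (Xv ω)))) (fun u => T u (Xv ω))] at h3
    rw [Real.dist_eq, abs_le]
    change -(1 / ((n : ℝ) + 1)) ≤ Dd d L (fun u => T u (x n (c n (Xv ω)))) (Yv ω) -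
      Dd d L (fun u => T u (Xv ω)) (Yv ω) ∧ Dd d L (fun u => T u (x n (c n (Xv ω)))) (Yv ω) -
      Dd d L (fun u => T u (Xv ω)) (Yv ω) ≤ _
    constructor <;> linarith

/-- Discretisation: from an almost optimal coupling to a finite kernel. -/
theorem exists_kernel_of_RL_lt (hT : IsContAction d T) (ν : Measure X) [IsProbabilityMeasure ν]
    (L ε η : ℝ) (hL : 0 < L) {N : ℕ} (c : X → Fin N) (hc : Measurable c) (x : Fin N → X)
    (hx : ∀ y, ∀ u ∈ unitBox d L, dist (T u y) (T u (x (c y))) ≤ η) (a : ℝ≥0∞)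
    (ha : RL d T ν L ε < a) :
    ∃ K : Fin N → Fin N → ℝ, (∀ i s, 0 ≤ K i s) ∧ (∀ i, ∑ s, K i s = 1) ∧
      ENNReal.ofReal (Iu (fun i => (ν (c ⁻¹' {i})).toReal) K / Real.log 2) ≤ a ∧
      ∑ i, ∑ s, (ν (c ⁻¹' {i})).toReal * K i s * Dn d T L (x i) (fun u => T u (x s)) <
        2 * (ε + η) := by
  have hne : Nonempty X := ν.nonempty_of_neZero
  unfold RL at ha
  simp only [iInf_lt_iff] at ha
  obtain ⟨Ω, mΩ, P, hP, Xv, Yv, hX, hY, hlaw, hdist, hI⟩ := ha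
  obtain ⟨J, hJ, hJ1⟩ := measurable_choice
    (fun (g : L1Maps d L X) (i : Fin N) => ∀ j, Dn d T L (x i) g ≤ Dn d T L (x j) g) (by
      intro g
      have : Nonempty (Fin N) := ⟨c hne.some⟩
      exact Finite.exists_min fun j => Dn d T L (x j) g) (by
      intro i
      simp only [ofPred_forall]
      exact MeasurableSet.iInter fun j =>
        measurableSet_le (measurable_Dn_L1 hT L _) (measurable_Dn_L1 hT L _))
  set U : Ω → Fin N := fun ω => c (Xv ω) with hU
  set V : Ω → Fin N := fun ω => J (Yv ω) with hV
  have hUm : Measurable U := hc.comp hX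
  have hVm : Measurable V := hJ.comp hY
  set r : Fin N → Fin N → ℝ := fun i s => (P ((fun ω => (U ω, V ω)) ⁻¹' {(i, s)})).toReal with hr
  have hr0 : ∀ i s, 0 ≤ r i s := fun i s => ENNReal.toReal_nonneg
  set p : Fin N → ℝ := fun i => (ν (c ⁻¹' {i})).toReal with hp
  have hpr : ∀ i, p i = ∑ s, r i s := by
    intro i
    rw [← toReal_sum_fiber P U V hUm hVm i]
    simp only [hp]
    rw [← hlaw, Measure.map_apply hX (hc (measurableSet_singleton i))]; rfl
  have hp1 : ∑ i, p i = 1 := by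
    have := integral_finite_comp ν c hc (fun _ => (1 : ℝ))
    simp only [integral_const, smul_eq_mul, mul_one, probReal_univ] at this
    exact this.symm
  set K : Fin N → Fin N → ℝ := fun i s => if p i = 0 then (if i = s then 1 else 0) else
    r i s / p i with hK
  have hpK : ∀ i s, p i * K i s = r i s := by
    intro i s
    by_cases h : p i = 0
    · have := (Finset.sum_eq_zero_iff_of_nonneg (fun s _ => hr0 i s)).1
        ((hpr i).symm.trans h) s (Finset.mem_univ s)
      rw [h, this, zero_mul]
    · simp only [hK, h, if_false]; field_simp
  have hK0 : ∀ i s, 0 ≤ K i s := by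
    intro i s
    simp only [hK]
    split_ifs
    · norm_num
    · norm_num
    · exact div_nonneg (hr0 i s) ENNReal.toReal_nonneg
  have hK1 : ∀ i, ∑ s, K i s = 1 := by
    intro i
    by_cases h : p i = 0
    · simp [hK, h]
    · simp only [hK, h, if_false]
      rw [← Finset.sum_div, ← hpr, div_self h]
  refine ⟨K, hK0, hK1, ?_, ?_⟩
  · refine le_trans ?_ hI.le
    have h1 : Iu p K = MI r := by
      have := MI_kernel p K hK1
      simp only [hpK] at this
      rw [show MI r = MI (fun i s => r i s) from rfl, this, Iu, hp1, Real.negMulLog_one, sub_zero]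
      simp only [hpK]
    have h2 := shannon_MI P U V hUm hVm
    rw [h1, ← h2]
    unfold mutualInfo
    exact le_iSup_of_le N <| le_iSup_of_le N <| le_iSup_of_le c <| le_iSup_of_le hc <|
      le_iSup_of_le J <| le_iSup_of_le hJ le_rfl
  · have h1 : ∑ i, ∑ s, p i * K i s * Dn d T L (x i) (fun u => T u (x s)) =
        ∫ ω, Dn d T L (x (U ω)) (fun u => T u (x (V ω))) ∂P := by
      rw [integral_finite_comp P (fun ω => (U ω, V ω)) (hUm.prodMk hVm)
        (fun q => Dn d T L (x q.1) (fun u => T u (x q.2))), Fintype.sum_prod_type]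
      simp only [hpK, hr]
    rw [h1]
    have hpt : ∀ ω, Dn d T L (x (U ω)) (fun u => T u (x (V ω))) ≤
        2 * Dn d T L (Xv ω) (Yv ω) + 2 * η := by
      intro ω
      have e1 : Dd d L (fun u => T u (Xv ω)) (fun u => T u (x (U ω))) ≤ η :=
        Dn_le_of_le hT L hL (Xv ω) _ (measurable_orbit hT _) _ (hx (Xv ω))
      have e2 := Dd_triangle L hL _ _ _ (measurable_orbit hT (x (U ω)))
        (measurable_coeFn_L1 L (Yv ω)) (measurable_orbit hT (x (V ω)))
      have e3 := Dd_triangle L hL _ _ _ (measurable_orbit hT (x (U ω)))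
        (measurable_orbit hT (Xv ω)) (measurable_coeFn_L1 L (Yv ω))
      have e4 : Dd d L (fun u => T u (x (V ω))) (Yv ω) ≤ Dd d L (fun u => T u (x (U ω))) (Yv ω) :=
        hJ1 (Yv ω) (U ω)
      rw [Dd_comm L (Yv ω)] at e2
      rw [Dd_comm L (fun u => T u (x (U ω))) (fun u => T u (Xv ω))] at e3
      change Dd d L (fun u => T u (x (U ω))) (fun u => T u (x (V ω))) ≤
        2 * Dd d L (fun u => T u (Xv ω)) (Yv ω) + 2 * η
      linarith
    have hintg : Integrable (fun ω => Dn d T L (Xv ω) (Yv ω)) P := by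
      refine Integrable.of_bound (C := Metric.diam (univ : Set X))
        (measurable_Dn_pair hT L hL Xv Yv hX hY).aestronglyMeasurable
        (Eventually.of_forall fun ω => ?_)
      rw [Real.norm_eq_abs, abs_of_nonneg (Dn_nonneg L hL.le _ _)]
      exact Dn_le_diam hT L hL _ _ (measurable_coeFn_L1 L _)
    have h2 : ∫ ω, Dn d T L (x (U ω)) (fun u => T u (x (V ω))) ∂P ≤
        ∫ ω, (2 * Dn d T L (Xv ω) (Yv ω) + 2 * η) ∂P :=
      integral_mono_of_nonneg (Eventually.of_forall fun ω => Dn_nonneg L hL.le _ _)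
        ((hintg.const_mul 2).add (integrable_const _)) (Eventually.of_forall hpt)
    rw [integral_add (hintg.const_mul 2) (integrable_const _), integral_const_mul] at h2
    have h3 : ∫ ω, Dn d T L (Xv ω) (Yv ω) ∂P < ε := hdist
    simp only [integral_const, smul_eq_mul, probReal_univ, one_mul] at h2
    linarith

end

end RDB

open MeasureTheory Filter Set
open scoped ENNReal Topology NNReal
set_option linter.unusedSectionVars false

namespace RDB

noncomputable section

/-- Index of the subcube of side `L0` containing `u` (clipped). -/
def cubeIdx (d k : ℕ) (hk : 0 < k) (L0 : ℝ) (u : Fin d → ℝ) : Fin d → Fin k := fun i =>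
  ⟨min ⌊u i / L0⌋₊ (k - 1), by omega⟩

/-- Corner of the subcube with a given index. -/
def corner (d k : ℕ) (L0 : ℝ) (j : Fin d → Fin k) : Fin d → ℝ := fun i => L0 * ((j i : ℕ) : ℝ)

theorem measurable_cubeIdx (d k : ℕ) (hk : 0 < k) (L0 : ℝ) :
    Measurable (cubeIdx d k hk L0) := by
  refine measurable_pi_iff.2 fun i => ?_
  have h1 : Measurable fun u : Fin d → ℝ => ⌊u i / L0⌋₊ :=
    Nat.measurable_floor.comp (by fun_prop)
  exact (measurable_of_countable (fun n : ℕ => (⟨min n (k - 1), by omega⟩ : Fin k))).comp h1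

theorem cubeIdx_add (d k : ℕ) (hk : 0 < k) (L0 : ℝ) (hL0 : 0 < L0) (j : Fin d → Fin k)
    (v : Fin d → ℝ) (hv : v ∈ unitBox d L0) : cubeIdx d k hk L0 (v + corner d k L0 j) = j := by
  ext i
  have h := hv i (mem_univ i)
  simp only [cubeIdx, corner, Pi.add_apply]
  have h1 : ⌊(v i + L0 * ((j i : ℕ) : ℝ)) / L0⌋₊ = j i := by
    rw [Nat.floor_eq_iff]
    · constructor
      · rw [le_div_iff₀ hL0]; nlinarith [h.1]
      · rw [div_lt_iff₀ hL0]; nlinarith [h.2]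
    · have := h.1
      positivity
  rw [h1]
  have := (j i).2
  omega

theorem sub_corner_mem (d k : ℕ) (hk : 0 < k) (L0 : ℝ) (hL0 : 0 < L0)
    (u : Fin d → ℝ) (hu : u ∈ unitBox d (k * L0)) :
    u - corner d k L0 (cubeIdx d k hk L0 u) ∈ unitBox d L0 := by
  intro i _
  have h := hu i (mem_univ i)
  simp only [cubeIdx, corner, Pi.sub_apply]
  have h0 : 0 ≤ u i / L0 := div_nonneg h.1 hL0.le
  have h1 : ⌊u i / L0⌋₊ < k := by
    rw [Nat.floor_lt h0, div_lt_iff₀ hL0]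
    exact h.2
  have h2 : min ⌊u i / L0⌋₊ (k - 1) = ⌊u i / L0⌋₊ := by omega
  rw [h2]
  have h3 := Nat.floor_le h0
  have h4 := Nat.lt_floor_add_one (u i / L0)
  rw [le_div_iff₀ hL0] at h3
  rw [div_lt_iff₀ hL0] at h4
  constructor
  · nlinarith
  · nlinarith

theorem boxMeasure_le_sum (d k : ℕ) (hk : 0 < k) (L0 : ℝ) (hL0 : 0 < L0) :
    boxMeasure d (k * L0) ≤
      ∑ j : Fin d → Fin k, (boxMeasure d L0).map (fun v => v + corner d k L0 j) := by
  refine Measure.le_iff.2 fun A hA => ?_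
  rw [Measure.finsetSum_apply, boxMeasure, Measure.restrict_apply hA]
  have h1 : A ∩ unitBox d (k * L0) ⊆ ⋃ j ∈ (Finset.univ : Finset (Fin d → Fin k)),
      ((A ∩ unitBox d (k * L0)) ∩ {u | cubeIdx d k hk L0 u = j}) := by
    intro u hu; simpa using hu
  refine (measure_mono h1).trans ((measure_biUnion_finset_le _ _).trans ?_)
  refine Finset.sum_le_sum fun j _ => ?_
  rw [Measure.map_apply (by fun_prop) hA, boxMeasure,
    Measure.restrict_apply ((by fun_prop : Measurable fun v : Fin d → ℝ =>
      v + corner d k L0 j) hA),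
    ← measure_preimage_add_right volume (corner d k L0 j)]
  refine measure_mono ?_
  rintro v ⟨⟨hv1, hv2⟩, hv3⟩
  refine ⟨hv1, ?_⟩
  have := sub_corner_mem d k hk L0 hL0 _ hv2
  rw [show cubeIdx d k hk L0 (v + corner d k L0 j) = j from hv3] at this
  simpa using this

variable {X : Type*} [MetricSpace X] [CompactSpace X] [MeasurableSpace X] [BorelSpace X]
variable {d : ℕ} {T : (Fin d → ℝ) → X → X}

theorem Dn_mono_box (hT : IsContAction d T) (L L' : ℝ) (hL : 0 < L) (hLL : L ≤ L') (x : X)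
    (f : (Fin d → ℝ) → X) (hf : Measurable f) :
    Dn d T L x f ≤ (L' / L) ^ d * Dn d T L' x f := by
  have hL' : 0 < L' := hL.trans_le hLL
  have h1 : ∫ u, dist (T u x) (f u) ∂(boxMeasure d L) ≤
      ∫ u, dist (T u x) (f u) ∂(boxMeasure d L') := by
    refine integral_mono_measure ?_ (Eventually.of_forall fun u => dist_nonneg)
      (integrable_dist _ _ _ (measurable_orbit hT x) hf)
    exact Measure.restrict_mono (Set.pi_mono fun i _ => Set.Ico_subset_Ico le_rfl hLL) le_rfl
  unfold Dn
  have h2 : (L' / L) ^ d * ((L' ^ d)⁻¹ * ∫ u, dist (T u x) (f u) ∂(boxMeasure d L')) =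
      (L ^ d)⁻¹ * ∫ u, dist (T u x) (f u) ∂(boxMeasure d L') := by
    have : L' ^ d ≠ 0 := by positivity
    rw [div_pow]; field_simp
  rw [h2]
  exact mul_le_mul_of_nonneg_left h1 (by positivity)

/-- Concatenated orbit pieces. -/
def concat (d k : ℕ) (hk : 0 < k) (T : (Fin d → ℝ) → X → X) (L0 : ℝ)
    (z : (Fin d → Fin k) → X) (u : Fin d → ℝ) : X :=
  T (u - corner d k L0 (cubeIdx d k hk L0 u)) (z (cubeIdx d k hk L0 u))

theorem measurable_concat (hT : IsContAction d T) (k : ℕ) (hk : 0 < k) (L0 : ℝ)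
    (z : (Fin d → Fin k) → X) : Measurable (concat d k hk T L0 z) := by
  have h1 : Measurable fun p : (Fin d → Fin k) × (Fin d → ℝ) =>
      T (p.2 - corner d k L0 p.1) (z p.1) := by
    refine measurable_from_prod_countable_right fun j => ?_
    exact (measurable_orbit hT (z j)).comp (by fun_prop)
  exact h1.comp ((measurable_cubeIdx d k hk L0).prodMk measurable_id)

theorem Dn_concat (hT : IsContAction d T) (k : ℕ) (hk : 0 < k) (L0 : ℝ) (hL0 : 0 < L0)
    (z : (Fin d → Fin k) → X) (x : X) :
    Dn d T (k * L0) x (concat d k hk T L0 z) ≤ ((k : ℝ) ^ d)⁻¹ *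
      ∑ j, Dn d T L0 (T (corner d k L0 j) x) (fun u => T u (z j)) := by
  have hk' : (0 : ℝ) < k := by exact_mod_cast hk
  have hmeas : Measurable fun u => dist (T u x) (concat d k hk T L0 z u) :=
    (measurable_orbit hT x).dist (measurable_concat hT k hk L0 z)
  have hmap : ∀ j, Measurable fun v : Fin d → ℝ => v + corner d k L0 j := fun j => by fun_prop
  have hintg : ∀ j : Fin d → Fin k, Integrable (fun u => dist (T u x) (concat d k hk T L0 z u))
      ((boxMeasure d L0).map (fun v => v + corner d k L0 j)) := fun j =>
    integrable_dist _ _ _ (measurable_orbit hT x) (measurable_concat hT k hk L0 z)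
  have h1 : ∫ u, dist (T u x) (concat d k hk T L0 z u) ∂(boxMeasure d (k * L0)) ≤
      ∑ j, ∫ v, dist (T v (T (corner d k L0 j) x)) (T v (z j)) ∂(boxMeasure d L0) := by
    refine (integral_mono_measure (boxMeasure_le_sum d k hk L0 hL0)
      (Eventually.of_forall fun u => dist_nonneg) ?_).trans ?_
    · exact integrable_finsetSum_measure.2 fun j _ => hintg j
    rw [integral_finsetSum_measure (fun j _ => hintg j)]
    refine le_of_eq (Finset.sum_congr rfl fun j _ => ?_)
    rw [integral_map (hmap j).aemeasurable hmeas.aestronglyMeasurable]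
    refine setIntegral_congr_fun (measurableSet_unitBox d L0) fun v hv => ?_
    simp only [concat, cubeIdx_add d k hk L0 hL0 j v hv, hT.2.2]
    simp
  unfold Dn
  rw [← Finset.mul_sum, ← mul_assoc, ← mul_inv, ← mul_pow]
  exact mul_le_mul_of_nonneg_left h1 (by positivity)

theorem block_upper (hT : IsContAction d T) (μ : Measure X) [IsProbabilityMeasure μ]
    {B : Type} [Fintype B] (μb : B → Measure X) (hsum : ∑ b, μb b = μ)
    (hinv : ∀ b, MeasInvariant d T (μb b)) {N : ℕ} (L0 : ℝ) (hL0 : 0 < L0)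
    (c : X → Fin N) (hc : Measurable c) (x : Fin N → X) (η : ℝ)
    (hx : ∀ y, ∀ u ∈ unitBox d L0, dist (T u y) (T u (x (c y))) ≤ η)
    (K : B → Fin N → Fin N → ℝ) (hK0 : ∀ b i s, 0 ≤ K b i s) (hK1 : ∀ b i, ∑ s, K b i s = 1)
    (k : ℕ) (hk : 0 < k) (L ε : ℝ) (hL : 0 < L) (hLk : L ≤ k * L0)
    (hD : (k * L0 / L) ^ d * ∑ b, ∑ i, ∑ s, (μb b (c ⁻¹' {i})).toReal * (K b i s *
      (η + Dn d T L0 (x i) (fun u => T u (x s)))) < ε) :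
    RL d T μ L ε ≤ ENNReal.ofReal ((∑ b, Real.negMulLog (∑ i, (μb b (c ⁻¹' {i})).toReal) +
      k ^ d * ∑ b, Iu (fun i => (μb b (c ⁻¹' {i})).toReal) (K b)) / Real.log 2) := by
  classical
  have hk' : (0 : ℝ) < k := by exact_mod_cast hk
  have hfin : ∀ b, IsFiniteMeasure (μb b) := by
    intro b
    refine isFiniteMeasure_of_le μ ?_
    rw [← hsum]
    refine Measure.le_iff.2 fun A _ => ?_
    rw [Measure.finsetSum_apply]
    exact Finset.single_le_sum (f := fun b => μb b A) (fun _ _ => bot_le) (Finset.mem_univ b)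
  have hTm : ∀ u, Measurable (T u) := fun u =>
    (hT.1.comp (by fun_prop : Continuous fun x : X => (u, x))).measurable
  let cv : X → (Fin d → Fin k) → Fin N := fun y j => c (T (corner d k L0 j) y)
  have hcv : Measurable cv := measurable_pi_iff.2 fun j => hc.comp (hTm _)
  set M : B → ((Fin d → Fin k) → Fin N) → ℝ := fun b i => (μb b (cv ⁻¹' {i})).toReal with hM
  set m : B → Fin N → ℝ := fun b i => (μb b (c ⁻¹' {i})).toReal with hm
  have hmarg : ∀ b (j : Fin d → Fin k) (f : Fin N → ℝ), ∑ i, M b i * f (i j) = ∑ i, m b i * f i := by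
    intro b j f
    have := hfin b
    rw [← integral_finite_comp (μb b) cv hcv (fun i => f (i j)),
      ← integral_finite_comp (μb b) c hc f]
    conv_rhs => rw [← hinv b (corner d k L0 j)]
    rw [integral_map (hTm _).aemeasurable]
    exact ((measurable_of_finite f).comp hc).aestronglyMeasurable
  have hmt : ∀ b, ∑ i, M b i = ∑ i, m b i := by
    intro b
    have := hfin b
    have e1 := integral_finite_comp (μb b) cv hcv (fun _ => (1 : ℝ))
    have e2 := integral_finite_comp (μb b) c hc (fun _ => (1 : ℝ))
    simp only [mul_one] at e1 e2
    exact e1.symm.trans e2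
  have hblock := block_bound M (fun b i => ENNReal.toReal_nonneg) m
    (fun b i => ENNReal.toReal_nonneg) hmt hmarg K hK0 hK1
  rw [Fintype.card_fun, Fintype.card_fin, Fintype.card_fin] at hblock
  have key := RL_le_of_coupling hT μ (I := B × ((Fin d → Fin k) → Fin N))
    (S := (Fin d → Fin k) → Fin N)
    (fun q => (μb q.1).restrict (cv ⁻¹' {q.2}))
    (by
      rw [Fintype.sum_prod_type, ← hsum]
      exact Finset.sum_congr rfl fun b _ => sum_restrict_fiber (μb b) cv hcv)
    (fun q s => ∏ j, K q.1 (q.2 j) (s j))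
    (fun q s => Finset.prod_nonneg fun j _ => hK0 _ _ _)
    (fun q => sum_pi_prod (fun j t => K q.1 (q.2 j) t) (fun j => hK1 _ _))
    (fun s => concat d k hk T L0 (fun j => x (s j)))
    (fun s => measurable_concat hT k hk L0 _) L ε hL ?_
  · refine key.trans (ENNReal.ofReal_le_ofReal ?_)
    refine div_le_div_of_nonneg_right ?_ (Real.log_nonneg (by norm_num))
    simp only [Measure.restrict_apply_univ, Fintype.sum_prod_type]
    push_cast at hblock
    exact hblock
  · refine lt_of_le_of_lt ?_ hD
    rw [Fintype.sum_prod_type]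
    have hpt : ∀ b i (s : (Fin d → Fin k) → Fin N), ∫ y in cv ⁻¹' {i}, Dn d T L y (concat d k hk T L0 (fun j => x (s j))) ∂(μb b)
        ≤ M b i * ((k * L0 / L) ^ d * (((k : ℝ) ^ d)⁻¹ * ∑ j, (η +
          Dn d T L0 (x (i j)) (fun u => T u (x (s j)))))) := by
      intro b i s
      have := hfin b
      have h2 : ∫ y in cv ⁻¹' {i}, Dn d T L y (concat d k hk T L0 (fun j => x (s j))) ∂(μb b) ≤
          ∫ y in cv ⁻¹' {i}, ((k * L0 / L) ^ d * (((k : ℝ) ^ d)⁻¹ * ∑ j, (η +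
          Dn d T L0 (x (i j)) (fun u => T u (x (s j)))))) ∂(μb b) := by
        refine integral_mono_of_nonneg (Eventually.of_forall fun y => Dn_nonneg L hL.le _ _)
          (integrable_const _) ?_
        refine (ae_restrict_iff' (hcv (measurableSet_singleton i))).2
          (Eventually.of_forall fun y hy => ?_)
        refine (Dn_mono_box hT L (k * L0) hL hLk y _ (measurable_concat hT k hk L0 _)).trans ?_
        refine mul_le_mul_of_nonneg_left ?_ (by positivity)
        refine (Dn_concat hT k hk L0 hL0 _ y).trans ?_
        refine mul_le_mul_of_nonneg_left ?_ (by positivity)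
        refine Finset.sum_le_sum fun j _ => ?_
        have hcj : c (T (corner d k L0 j) y) = i j := congrFun (show cv y = i from hy) j
        have e1 : Dd d L0 (fun u => T u (T (corner d k L0 j) y)) (fun u => T u (x (i j))) ≤ η := by
          refine Dn_le_of_le hT L0 hL0 _ _ (measurable_orbit hT _) _ fun u hu => ?_
          have := hx (T (corner d k L0 j) y) u hu
          rwa [hcj] at this
        have e2 := Dd_triangle L0 hL0 _ _ _ (measurable_orbit hT (T (corner d k L0 j) y))
          (measurable_orbit hT (x (i j))) (measurable_orbit hT (x (s j)))
        change Dd d L0 (fun u => T u (T (corner d k L0 j) y)) (fun u => T u (x (s j))) ≤ η +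
          Dd d L0 (fun u => T u (x (i j))) (fun u => T u (x (s j)))
        linarith
      rw [integral_const, smul_eq_mul] at h2
      simpa [Measure.real] using h2
    have hone : ∀ b j, ∑ i : (Fin d → Fin k) → Fin N, ∑ s : (Fin d → Fin k) → Fin N,
        (∏ j, K b (i j) (s j)) * (M b i * (η + Dn d T L0 (x (i j)) (fun u => T u (x (s j))))) =
        ∑ i, ∑ s, m b i * (K b i s * (η + Dn d T L0 (x i) (fun u => T u (x s)))) := by
      intro b j
      have e1 := hmarg b j (fun i => ∑ s, K b i s * (η + Dn d T L0 (x i) (fun u => T u (x s))))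
      simp only [← Finset.mul_sum]
      rw [← e1]
      refine Finset.sum_congr rfl fun i _ => ?_
      rw [← sum_pi_prod_mul (fun j t => K b (i j) t) (fun j => hK1 _ _) j
        (fun t => η + Dn d T L0 (x (i j)) (fun u => T u (x t))), Finset.mul_sum]
      exact Finset.sum_congr rfl fun s _ => by ring
    calc _ ≤ ∑ b, ∑ i : (Fin d → Fin k) → Fin N, ∑ s : (Fin d → Fin k) → Fin N,
          (∏ j, K b (i j) (s j)) * (M b i * ((k * L0 / L) ^ d * (((k : ℝ) ^ d)⁻¹ * ∑ j, (η +
          Dn d T L0 (x (i j)) (fun u => T u (x (s j))))))) := by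
          refine Finset.sum_le_sum fun b _ => Finset.sum_le_sum fun i _ =>
            Finset.sum_le_sum fun s _ => ?_
          exact mul_le_mul_of_nonneg_left (hpt b i s) (Finset.prod_nonneg fun j _ => hK0 _ _ _)
      _ = (k * L0 / L) ^ d * (((k : ℝ) ^ d)⁻¹ * ∑ b, ∑ j : Fin d → Fin k,
          ∑ i : (Fin d → Fin k) → Fin N, ∑ s : (Fin d → Fin k) → Fin N,
          (∏ j, K b (i j) (s j)) * (M b i * (η + Dn d T L0 (x (i j)) (fun u => T u (x (s j)))))) := by
          simp only [Finset.mul_sum]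
          refine Finset.sum_congr rfl fun b _ => ?_
          rw [Finset.sum_comm (s := (Finset.univ : Finset (Fin d → Fin k)))]
          refine Finset.sum_congr rfl fun i _ => ?_
          rw [Finset.sum_comm (s := (Finset.univ : Finset (Fin d → Fin k)))]
          refine Finset.sum_congr rfl fun s _ => Finset.sum_congr rfl fun j _ => ?_
          ring
      _ = _ := by
          simp only [hone, Finset.sum_const, Finset.card_univ, Fintype.card_fun, Fintype.card_fin,
            nsmul_eq_mul]
          rw [← Finset.mul_sum]
          congr 1
          push_cast
          rw [← mul_assoc, inv_mul_cancel₀ (by positivity), one_mul]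

end

end RDB

open MeasureTheory Filter Set
open scoped ENNReal Topology NNReal
set_option linter.unusedSectionVars false

namespace RDB

noncomputable section

variable {X : Type*} [MetricSpace X] [CompactSpace X] [MeasurableSpace X] [BorelSpace X]
variable {d : ℕ} {T : (Fin d → ℝ) → X → X}

theorem sum_fiber_one {V : Type*} [Fintype V] [MeasurableSpace V]
    [MeasurableSingletonClass V] (ν : Measure X) [IsProbabilityMeasure ν] (c : X → V)
    (hc : Measurable c) : ∑ i, (ν (c ⁻¹' {i})).toReal = 1 := by
  have h3 := integral_finite_comp ν c hc (fun _ => (1 : ℝ))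
  simp only [integral_const, smul_eq_mul, mul_one, probReal_univ] at h3
  exact h3.symm

theorem lintegral_finite_comp {Ω V : Type*} [MeasurableSpace Ω] [Fintype V] [MeasurableSpace V]
    [MeasurableSingletonClass V] (P : Measure Ω) (f : Ω → V)
    (hf : Measurable f) (g : V → ℝ≥0∞) :
    ∫⁻ ω, g (f ω) ∂P = ∑ v, P (f ⁻¹' {v}) * g v := by
  rw [← lintegral_map (f := g) (measurable_of_finite g) hf, lintegral_fintype]
  refine Finset.sum_congr rfl fun v _ => ?_
  rw [Measure.map_apply hf (measurableSet_singleton v), mul_comm]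

theorem ofReal_div_pow (A L : ℝ) (hL : 0 < L) :
    ENNReal.ofReal A / ENNReal.ofReal (L ^ d) = ENNReal.ofReal (A / L ^ d) :=
  (ENNReal.ofReal_div_of_pos (pow_pos hL d)).symm

theorem RL_eventually (hT : IsContAction d T) (ν : Measure X) [IsProbabilityMeasure ν]
    (hν : MeasInvariant d T ν) (L0 ε : ℝ) (hL0 : 0 < L0) (hε : 0 < ε) (a : ℝ≥0∞)
    (ha : RL d T ν L0 ε < a) (haT : a ≠ ⊤) (θ : ℝ) (hθ : 1 < θ) (hθ2 : θ ≤ 2) :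
    ∀ᶠ L : ℝ in atTop, RL d T ν L (16 * ε) / ENNReal.ofReal (L ^ d) ≤
      ENNReal.ofReal θ * (a / ENNReal.ofReal (L0 ^ d)) := by
  have hne : Nonempty X := ν.nonempty_of_neZero
  obtain ⟨c, hc, x, hx⟩ := exists_cells hT L0 ε hε
  obtain ⟨K, hK0, hK1, hKI, hKD⟩ := exists_kernel_of_RL_lt hT ν L0 ε ε hL0 c hc x hx a ha
  have hlim : Tendsto (fun L : ℝ => (1 + L0 / L) ^ d) atTop (𝓝 1) := by
    have h1 : Tendsto (fun L : ℝ => 1 + L0 / L) atTop (𝓝 (1 + 0)) :=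
      tendsto_const_nhds.add (tendsto_const_nhds.div_atTop tendsto_id)
    have := h1.pow d
    simpa using this
  filter_upwards [hlim.eventually (gt_mem_nhds hθ), eventually_gt_atTop 0] with L hLθ hL
  set k := ⌈L / L0⌉₊ with hk
  have hk0 : 0 < k := Nat.ceil_pos.2 (div_pos hL hL0)
  have hk' : (0 : ℝ) < k := by exact_mod_cast hk0
  have h1 : L ≤ k * L0 := by
    rw [← div_le_iff₀ hL0]; exact Nat.le_ceil _
  have h2 : k * L0 ≤ L + L0 := by
    have : (k : ℝ) < L / L0 + 1 := Nat.ceil_lt_add_one (div_pos hL hL0).le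
    have h3 : (L / L0 + 1) * L0 = L + L0 := by field_simp
    nlinarith
  have h3 : (k * L0 / L) ^ d ≤ θ := by
    refine le_trans (pow_le_pow_left₀ (by positivity) ?_ d) hLθ.le
    rw [div_le_iff₀ hL]
    have : (1 + L0 / L) * L = L + L0 := by field_simp
    linarith
  have h0 : 0 ≤ (k * L0 / L) ^ d := by positivity
  have key := block_upper hT ν (B := Unit) (fun _ => ν) (by simp) (fun _ => hν) L0 hL0 c hc x ε hx
    (fun _ => K) (fun _ => hK0) (fun _ => hK1) k hk0 L (16 * ε) hL h1 (by
      have e1 : ∑ i, ∑ s, (ν (c ⁻¹' {i})).toReal * (K i s *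
          (ε + Dn d T L0 (x i) (fun u => T u (x s)))) = ε +
          ∑ i, ∑ s, (ν (c ⁻¹' {i})).toReal * K i s * Dn d T L0 (x i) (fun u => T u (x s)) := by
        have e2 : ∀ i, ∑ s, (ν (c ⁻¹' {i})).toReal * (K i s *
          (ε + Dn d T L0 (x i) (fun u => T u (x s)))) = (ν (c ⁻¹' {i})).toReal * ε +
          ∑ s, (ν (c ⁻¹' {i})).toReal * K i s * Dn d T L0 (x i) (fun u => T u (x s)) := by
          intro i
          have e3 : (ν (c ⁻¹' {i})).toReal * ε = ∑ s, (ν (c ⁻¹' {i})).toReal * ε * K i s := by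
            rw [← Finset.mul_sum, hK1, mul_one]
          rw [e3, ← Finset.sum_add_distrib]
          exact Finset.sum_congr rfl fun s _ => by ring
        simp only [e2]
        rw [Finset.sum_add_distrib, ← Finset.sum_mul, sum_fiber_one ν c hc, one_mul]
      simp only [Finset.univ_unique, Finset.sum_singleton]
      rw [e1]
      nlinarith)
  simp only [Finset.univ_unique, Finset.sum_singleton, sum_fiber_one ν c hc, Real.negMulLog_one,
    zero_add] at key
  set I := Iu (fun i => (ν (c ⁻¹' {i})).toReal) K / Real.log 2 with hI
  have hI0 : 0 ≤ I := div_nonneg (Iu_nonneg _ (fun _ => ENNReal.toReal_nonneg)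
    (sum_fiber_one ν c hc) _ hK0) (Real.log_nonneg (by norm_num))
  have haI : I ≤ a.toReal := by
    rw [← ENNReal.ofReal_le_iff_le_toReal haT]; exact hKI
  rw [mul_div_assoc, ← hI] at key
  rw [← ENNReal.ofReal_toReal haT, ofReal_div_pow _ _ hL0, ← ENNReal.ofReal_mul (by linarith)]
  refine (ENNReal.div_le_div_right key _).trans ?_
  rw [ofReal_div_pow _ _ hL]
  refine ENNReal.ofReal_le_ofReal ?_
  have e : (k : ℝ) ^ d * I / L ^ d = (k * L0 / L) ^ d * (I / L0 ^ d) := by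
    rw [div_pow, mul_pow]; field_simp
  rw [e]
  have h5 : I / L0 ^ d ≤ a.toReal / L0 ^ d := div_le_div_of_nonneg_right haI (by positivity)
  have h6 : 0 ≤ I / L0 ^ d := div_nonneg hI0 (by positivity)
  exact mul_le_mul h3 h5 h6 (by linarith)

theorem limsup_RL_le (hT : IsContAction d T) (ν : Measure X) [IsProbabilityMeasure ν]
    (hν : MeasInvariant d T ν) (ε : ℝ) (hε : 0 < ε) :
    limsup (fun L : ℝ => RL d T ν L (16 * ε) / ENNReal.ofReal (L ^ d)) atTop ≤ RD d T ν ε := by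
  refine le_of_forall_gt_imp_ge_of_dense fun a ha => ?_
  rcases eq_or_ne a ⊤ with rfl | haT
  · exact le_top
  have ha2 := ha
  unfold RD at ha2
  simp only [iInf_lt_iff] at ha2
  obtain ⟨L0, hL0, hlt⟩ := ha2
  have hp : ENNReal.ofReal (L0 ^ d) ≠ 0 := by simpa using pow_pos hL0 d
  have hlt' : RL d T ν L0 ε < a * ENNReal.ofReal (L0 ^ d) := by
    rwa [ENNReal.div_lt_iff (Or.inl hp) (Or.inl ENNReal.ofReal_ne_top)] at hlt
  have hev : ∀ θ : ℝ, 1 < θ → θ ≤ 2 → limsup (fun L : ℝ => RL d T ν L (16 * ε) /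
      ENNReal.ofReal (L ^ d)) atTop ≤ ENNReal.ofReal θ * a := by
    intro θ h1 h2
    have := RL_eventually hT ν hν L0 ε hL0 hε _ hlt' (ENNReal.mul_ne_top haT ENNReal.ofReal_ne_top)
      θ h1 h2
    rw [ENNReal.mul_div_cancel_right hp ENNReal.ofReal_ne_top] at this
    exact limsup_le_of_le (by isBoundedDefault) this
  have hlim : Tendsto (fun θ : ℝ => ENNReal.ofReal θ * a) (𝓝[>] 1) (𝓝 (ENNReal.ofReal 1 * a)) := by
    refine ENNReal.Tendsto.mul_const ?_ (Or.inr haT)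
    exact (ENNReal.continuous_ofReal.tendsto 1).mono_left nhdsWithin_le_nhds
  rw [ENNReal.ofReal_one, one_mul] at hlim
  refine ge_of_tendsto hlim ?_
  filter_upwards [Ioc_mem_nhdsGT (show (1 : ℝ) < 2 by norm_num)] with θ hθ
  exact hev θ hθ.1 hθ.2

/-- near-optimal kernel that works for all nearby probability vectors -/
theorem exists_robust_kernel (hT : IsContAction d T) {N : ℕ} (L0 ε δ : ℝ) (hL0 : 0 < L0)
    (hε : 0 < ε) (hδ : 0 < δ)
    (c : X → Fin N) (hc : Measurable c) (x : Fin N → X)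
    (hx : ∀ y, ∀ u ∈ unitBox d L0, dist (T u y) (T u (x (c y))) ≤ ε) :
    ∃ κ > 0, ∀ (ν : Measure X) (_ : IsProbabilityMeasure ν) (a : ℝ≥0∞), a ≠ ⊤ →
      RL d T ν L0 ε < a → ∃ K : Fin N → Fin N → ℝ, (∀ i s, 0 ≤ K i s) ∧ (∀ i, ∑ s, K i s = 1) ∧
      ∀ p : Fin N → ℝ, (∀ i, 0 ≤ p i) → ∑ i, p i = 1 →
        (∀ i, |p i - (ν (c ⁻¹' {i})).toReal| ≤ κ) →
        Iu p K / Real.log 2 ≤ a.toReal + δ ∧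
        ∑ i, ∑ s, p i * (K i s * (ε + Dn d T L0 (x i) (fun u => T u (x s)))) ≤ 6 * ε := by
  have hl2 : 0 < Real.log 2 := Real.log_pos (by norm_num)
  obtain ⟨κ1, hκ1, hu⟩ := Iu_unif_cont (N := N) (δ * Real.log 2) (by positivity)
  set D := Metric.diam (univ : Set X) with hDdef
  have hD0 : 0 ≤ D := Metric.diam_nonneg
  have hND : 0 ≤ (N : ℝ) * D := by positivity
  refine ⟨min κ1 (ε / (N * D + 1)), lt_min hκ1 (by positivity), ?_⟩
  intro ν _ a haT ha
  obtain ⟨K, hK0, hK1, hKI, hKD⟩ := exists_kernel_of_RL_lt hT ν L0 ε ε hL0 c hc x hx a ha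
  refine ⟨K, hK0, hK1, fun p hp0 hp1 hpκ => ⟨?_, ?_⟩⟩
  · have h1 := hu p _ K hp0 hp1 (fun _ => ENNReal.toReal_nonneg) (sum_fiber_one ν c hc) hK0 hK1
      (fun i => (hpκ i).trans (min_le_left _ _))
    have h2 := (ENNReal.ofReal_le_iff_le_toReal haT).1 hKI
    rw [div_le_iff₀ hl2] at h2 ⊢
    linarith
  · have hρ0 : ∀ i s, 0 ≤ Dn d T L0 (x i) (fun u => T u (x s)) := fun i s =>
      Dn_nonneg L0 hL0.le _ _
    have hρD : ∀ i s, Dn d T L0 (x i) (fun u => T u (x s)) ≤ D := fun i s =>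
      Dn_le_diam hT L0 hL0 _ _ (measurable_orbit hT _)
    have hκ2 : min κ1 (ε / (N * D + 1)) * (N * D) ≤ ε := by
      have e1 : min κ1 (ε / (N * D + 1)) * (N * D) ≤ (ε / (N * D + 1)) * (N * D) :=
        mul_le_mul_of_nonneg_right (min_le_right _ _) hND
      refine e1.trans ?_
      rw [div_mul_eq_mul_div, div_le_iff₀ (by positivity)]
      nlinarith
    set κ := min κ1 (ε / (N * D + 1)) with hκ
    have hκ0 : 0 ≤ κ := (lt_min hκ1 (by positivity)).le
    have hrow : ∀ i, ∑ s, p i * (K i s * (ε + Dn d T L0 (x i) (fun u => T u (x s)))) ≤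
        p i * ε + (∑ s, (ν (c ⁻¹' {i})).toReal * K i s * Dn d T L0 (x i) (fun u => T u (x s))
          + κ * D) := by
      intro i
      have e1 : p i * ε = ∑ s, K i s * (p i * ε) := by rw [← Finset.sum_mul, hK1, one_mul]
      have e2 : κ * D = ∑ s, K i s * (κ * D) := by rw [← Finset.sum_mul, hK1, one_mul]
      rw [e1, e2, ← Finset.sum_add_distrib, ← Finset.sum_add_distrib]
      refine Finset.sum_le_sum fun s _ => ?_
      have e3 : p i - (ν (c ⁻¹' {i})).toReal ≤ κ := (le_abs_self _).trans (hpκ i)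
      have e4 : (p i - (ν (c ⁻¹' {i})).toReal) * Dn d T L0 (x i) (fun u => T u (x s)) ≤ κ * D :=
        (mul_le_mul_of_nonneg_right e3 (hρ0 i s)).trans
          (mul_le_mul_of_nonneg_left (hρD i s) hκ0)
      have e5 := mul_le_mul_of_nonneg_left e4 (hK0 i s)
      nlinarith
    refine (Finset.sum_le_sum fun i _ => hrow i).trans ?_
    rw [Finset.sum_add_distrib, Finset.sum_add_distrib, ← Finset.sum_mul, hp1]
    simp only [Finset.sum_const, Finset.card_univ, Fintype.card_fin, nsmul_eq_mul]
    linarith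

theorem measurable_eval (A : Set X) (hA : MeasurableSet A) :
    Measurable fun ν : InvM X d T => (ν.1 : Measure X) A :=
  (Measure.measurable_coe hA).comp (measurable_subtype_coe.comp measurable_subtype_coe)

theorem measurable_coeM : Measurable fun ν : InvM X d T => (ν.1 : Measure X) :=
  measurable_subtype_coe.comp measurable_subtype_coe

theorem exists_quantize {N : ℕ} (c : X → Fin N) (hc : Measurable c) (κ : ℝ) (hκ : 0 < κ) :
    ∃ (Q : ℕ) (q : InvM X d T → (Fin N → Fin (Q + 1))), Measurable q ∧ ∀ ν ν', q ν = q ν' → ∀ i,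
      |((ν.1 : Measure X) (c ⁻¹' {i})).toReal - ((ν'.1 : Measure X) (c ⁻¹' {i})).toReal| ≤ κ := by
  obtain ⟨n, hn⟩ := exists_nat_one_div_lt hκ
  set Q := n + 1 with hQ
  have hQ0 : (0 : ℝ) < Q := by simp [hQ]; positivity
  have hp1 : ∀ (ν : InvM X d T) i, ((ν.1 : Measure X) (c ⁻¹' {i})).toReal ≤ 1 := fun ν i => by
    have : (ν.1 : Measure X).real (c ⁻¹' {i}) ≤ 1 := measureReal_le_one
    exact this
  refine ⟨Q, fun ν i => ⟨⌊Q * ((ν.1 : Measure X) (c ⁻¹' {i})).toReal⌋₊, ?_⟩, ?_, ?_⟩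
  · refine Nat.lt_succ_of_le (Nat.floor_le_of_le ?_)
    have := hp1 ν i
    nlinarith
  · refine measurable_pi_iff.2 fun i => measurable_to_countable' fun j => ?_
    have hm : Measurable fun ν : InvM X d T => ⌊Q * ((ν.1 : Measure X) (c ⁻¹' {i})).toReal⌋₊ :=
      Nat.measurable_floor.comp ((measurable_eval _ (hc (measurableSet_singleton i))).ennreal_toReal.const_mul _)
    have := hm (measurableSet_singleton (j : ℕ))
    convert this using 1
    ext ν
    simp [Fin.ext_iff]
  · intro ν ν' h i
    have h1 := congrArg Fin.val (congrFun h i)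
    simp only at h1
    set r := ((ν.1 : Measure X) (c ⁻¹' {i})).toReal
    set r' := ((ν'.1 : Measure X) (c ⁻¹' {i})).toReal
    have hr : 0 ≤ r := ENNReal.toReal_nonneg
    have hr' : 0 ≤ r' := ENNReal.toReal_nonneg
    have a1 := Nat.floor_le (show 0 ≤ Q * r by positivity)
    have a2 := Nat.lt_floor_add_one (Q * r)
    have a3 := Nat.floor_le (show 0 ≤ Q * r' by positivity)
    have a4 := Nat.lt_floor_add_one (Q * r')
    rw [h1] at a1 a2
    have hn' : 1 ≤ Q * κ := by
      rw [div_lt_iff₀ (by positivity)] at hn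
      have : (Q : ℝ) = n + 1 := by simp [hQ]
      rw [this]; linarith
    rw [abs_le]
    constructor
    · by_contra hcon
      push Not at hcon
      nlinarith
    · by_contra hcon
      push Not at hcon
      nlinarith

end

end RDB

open MeasureTheory Filter Set
open scoped ENNReal Topology NNReal
set_option linter.unusedSectionVars false

namespace RDB

noncomputable section

variable {X : Type*} [MetricSpace X] [CompactSpace X] [MeasurableSpace X] [BorelSpace X]
variable {d : ℕ} {T : (Fin d → ℝ) → X → X}

theorem RL_lt_top (hT : IsContAction d T) (ν : Measure X) [IsProbabilityMeasure ν]
    (L ε : ℝ) (hL : 0 < L) (hε : 0 < ε) : RL d T ν L ε < ⊤ := by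
  have := RL_le_covNum hT ν L (ε / 2) hL (by linarith)
  rw [mul_div_cancel₀ _ (two_ne_zero)] at this
  exact this.trans_lt ENNReal.ofReal_lt_top

/-- mixture of the invariant measures over a cell -/
def mix (lam : Measure (InvM X d T)) : Measure X := lam.bind fun ν => (ν.1 : Measure X)

theorem mix_apply (lam : Measure (InvM X d T)) (A : Set X) (hA : MeasurableSet A) :
    mix lam A = ∫⁻ ν, (ν.1 : Measure X) A ∂lam :=
  Measure.bind_apply hA measurable_coeM.aemeasurable

theorem mix_univ (lam : Measure (InvM X d T)) : mix lam univ = lam univ := by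
  rw [mix_apply _ _ MeasurableSet.univ]
  simp

theorem mix_toReal (lam : Measure (InvM X d T)) (A : Set X)
    (hA : MeasurableSet A) :
    (mix lam A).toReal = ∫ ν, ((ν.1 : Measure X) A).toReal ∂lam := by
  rw [mix_apply _ _ hA, integral_toReal (measurable_eval A hA).aemeasurable
    (Eventually.of_forall fun ν => measure_lt_top _ _)]

theorem measurable_T (hT : IsContAction d T) (u : Fin d → ℝ) : Measurable (T u) :=
  (hT.1.comp (by fun_prop : Continuous fun x : X => (u, x))).measurable

theorem mix_inv (hT : IsContAction d T) (lam : Measure (InvM X d T)) :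
    MeasInvariant d T (mix lam) := by
  intro u
  have hTm := measurable_T hT u
  ext A hA
  rw [Measure.map_apply hTm hA, mix_apply _ _ hA, mix_apply _ _ (hTm hA)]
  refine lintegral_congr fun ν => ?_
  conv_rhs => rw [← ν.2 u]
  rw [Measure.map_apply hTm hA]

theorem exists_g (hd : 0 < d) (hT : IsContAction d T) (L0 ε δ : ℝ) (hL0 : 0 < L0) (hε : 0 < ε)
    (hδ : 0 < δ) : ∃ g : InvM X d T → ℝ≥0∞, Measurable g ∧
      (∀ ν, g ν ≤ RL d T (ν.1 : Measure X) L0 ε / ENNReal.ofReal (L0 ^ d)) ∧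
      ∀ (lam : Measure (InvM X d T)) (_ : IsProbabilityMeasure lam)
        (μ : Measure X) (_ : IsProbabilityMeasure μ)
        (_ : ∀ A : Set X, MeasurableSet A → μ A = ∫⁻ ν, (ν.1 : Measure X) A ∂lam),
        RD d T μ (8 * ε) ≤ ∫⁻ ν, g ν ∂lam + ENNReal.ofReal δ := by
  classical
  rcases isEmpty_or_nonempty X with hE | hne
  · refine ⟨fun _ => 0, measurable_const, fun _ => zero_le, ?_⟩
    intro lam _ μ hμ _
    exact absurd μ.nonempty_of_neZero (not_nonempty_iff.2 hE)
  have hl2 : 0 < Real.log 2 := Real.log_pos (by norm_num)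
  have hLd : 0 < L0 ^ d := pow_pos hL0 d
  obtain ⟨N, c, hc, x, hx⟩ : ∃ N : ℕ, ∃ c : X → Fin N, Measurable c ∧ ∃ x : Fin N → X,
      ∀ y, ∀ u ∈ unitBox d L0, dist (T u y) (T u (x (c y))) ≤ ε := ⟨_, exists_cells hT L0 ε hε⟩
  set δ' := δ * L0 ^ d / 4 with hδ'
  have hδ'0 : 0 < δ' := by positivity
  obtain ⟨κ, hκ, hrob⟩ := exists_robust_kernel hT L0 ε δ' hL0 hε hδ'0 c hc x hx
  obtain ⟨Q, q, hq, hqκ⟩ := exists_quantize (d := d) (T := T) c hc κ hκ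
  let B := Fin N → Fin (Q + 1)
  let V : B → ℝ≥0∞ := fun b => ⨅ (ν : InvM X d T) (_ : q ν = b), RL d T (ν.1 : Measure X) L0 ε
  have hker : ∀ b : B, ∃ K : Fin N → Fin N → ℝ, (∀ i s, 0 ≤ K i s) ∧ (∀ i, ∑ s, K i s = 1) ∧
      ((∃ ν, q ν = b) → V b ≠ ⊤ ∧ ∀ p : Fin N → ℝ, (∀ i, 0 ≤ p i) → ∑ i, p i = 1 →
        (∀ ν : InvM X d T, q ν = b → ∀ i, |p i - ((ν.1 : Measure X) (c ⁻¹' {i})).toReal| ≤ κ) →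
        Iu p K / Real.log 2 ≤ (V b).toReal + 2 * δ' ∧
        ∑ i, ∑ s, p i * (K i s * (ε + Dn d T L0 (x i) (fun u => T u (x s)))) ≤ 6 * ε) := by
    intro b
    by_cases hb : ∃ ν, q ν = b
    · obtain ⟨ν0, hν0⟩ := hb
      have hVT : V b ≠ ⊤ :=
        ((iInf₂_le ν0 hν0).trans_lt (RL_lt_top hT (ν0.1 : Measure X) L0 ε hL0 hε)).ne
      have hlt : V b < V b + ENNReal.ofReal δ' :=
        ENNReal.lt_add_right hVT (by simpa using hδ'0)
      have hlt2 := hlt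
      conv_lhs at hlt2 => simp only [V]
      simp only [iInf_lt_iff] at hlt2
      obtain ⟨ν1, hν1, hlt3⟩ := hlt2
      obtain ⟨K, hK0, hK1, hK⟩ := hrob (ν1.1 : Measure X) inferInstance (V b + ENNReal.ofReal δ')
        (ENNReal.add_ne_top.2 ⟨hVT, ENNReal.ofReal_ne_top⟩) hlt3
      refine ⟨K, hK0, hK1, fun _ => ⟨hVT, fun p hp0 hp1 hp => ?_⟩⟩
      obtain ⟨h1, h2⟩ := hK p hp0 hp1 (hp ν1 hν1)
      refine ⟨h1.trans ?_, h2⟩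
      rw [ENNReal.toReal_add hVT ENNReal.ofReal_ne_top, ENNReal.toReal_ofReal hδ'0.le]
      linarith
    · refine ⟨fun i s => if i = s then 1 else 0, fun i s => by dsimp only; split_ifs <;> norm_num,
        by simp, fun h => absurd h hb⟩
  choose K hK0 hK1 hK using hker
  refine ⟨fun ν => V (q ν) / ENNReal.ofReal (L0 ^ d), ?_, ?_, ?_⟩
  · exact (measurable_of_finite (fun b => V b / ENNReal.ofReal (L0 ^ d))).comp hq
  · intro ν
    exact ENNReal.div_le_div_right (iInf₂_le (f := fun (ν' : InvM X d T) (_ : q ν' = q ν) =>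
      RL d T (ν'.1 : Measure X) L0 ε) ν rfl) _
  intro lam _ μ _ hbar
  let lamb : B → Measure (InvM X d T) := fun b => lam.restrict (q ⁻¹' {b})
  set w : B → ℝ := fun b => (lam (q ⁻¹' {b})).toReal with hw
  have hw0 : ∀ b, 0 ≤ w b := fun b => ENNReal.toReal_nonneg
  have hw1 : ∑ b, w b = 1 := by
    have h3 := integral_finite_comp lam q hq (fun _ => (1 : ℝ))
    simp only [integral_const, smul_eq_mul, mul_one, probReal_univ] at h3
    exact h3.symm
  have hmass : ∀ b, ∑ i, (mix (lamb b) (c ⁻¹' {i})).toReal = w b := by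
    intro b
    have : IsFiniteMeasure (mix (lamb b)) := ⟨by rw [mix_univ]; exact measure_lt_top _ _⟩
    have h3 := integral_finite_comp (mix (lamb b)) c hc (fun _ => (1 : ℝ))
    simp only [integral_const, smul_eq_mul, mul_one] at h3
    rw [← h3, Measure.real, mix_univ, Measure.restrict_apply_univ]
  have hcell : ∀ b, Iu (fun i => (mix (lamb b) (c ⁻¹' {i})).toReal) (K b) ≤
      Real.log 2 * (w b * ((V b).toReal + 2 * δ')) ∧
      ∑ i, ∑ s, (mix (lamb b) (c ⁻¹' {i})).toReal * (K b i s *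
        (ε + Dn d T L0 (x i) (fun u => T u (x s)))) ≤ w b * (6 * ε) := by
    intro b
    rcases (hw0 b).eq_or_lt with h0 | hpos
    · have hz : ∀ i, (mix (lamb b) (c ⁻¹' {i})).toReal = 0 := by
        have h1 := hmass b
        rw [← h0] at h1
        intro i
        exact (Finset.sum_eq_zero_iff_of_nonneg (fun i _ => ENNReal.toReal_nonneg)).1 h1 i
          (Finset.mem_univ i)
      simp only [hz, ← h0]
      simp [Iu, Hn]
    · have hbne : ∃ ν, q ν = b := by
        by_contra hcon
        push Not at hcon
        have : q ⁻¹' {b} = ∅ := by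
          ext ν; simpa using hcon ν
        simp [hw, this] at hpos
      obtain ⟨hVT, hKp⟩ := hK b hbne
      set p : Fin N → ℝ := fun i => (mix (lamb b) (c ⁻¹' {i})).toReal / w b with hp
      have hmp : ∀ i, (mix (lamb b) (c ⁻¹' {i})).toReal = w b * p i := fun i => by
        simp only [hp]; field_simp
      have hp0 : ∀ i, 0 ≤ p i := fun i => div_nonneg ENNReal.toReal_nonneg (hw0 b)
      have hp1 : ∑ i, p i = 1 := by
        simp only [hp]; rw [← Finset.sum_div, hmass, div_self hpos.ne']
      have hclose : ∀ ν : InvM X d T, q ν = b → ∀ i,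
          |p i - ((ν.1 : Measure X) (c ⁻¹' {i})).toReal| ≤ κ := by
        intro ν hν i
        have hmeas : Measurable fun ν : InvM X d T => ((ν.1 : Measure X) (c ⁻¹' {i})).toReal :=
          (measurable_eval _ (hc (measurableSet_singleton i))).ennreal_toReal
        have hintg : Integrable (fun ν : InvM X d T => ((ν.1 : Measure X) (c ⁻¹' {i})).toReal)
            (lamb b) := by
          refine Integrable.of_bound (C := 1) hmeas.aestronglyMeasurable
            (Eventually.of_forall fun ν' => ?_)
          rw [Real.norm_eq_abs, abs_of_nonneg ENNReal.toReal_nonneg]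
          exact measureReal_le_one (μ := (ν'.1 : Measure X))
        have h1 : w b * p i - w b * ((ν.1 : Measure X) (c ⁻¹' {i})).toReal =
            ∫ ν' in q ⁻¹' {b}, (((ν'.1 : Measure X) (c ⁻¹' {i})).toReal -
              ((ν.1 : Measure X) (c ⁻¹' {i})).toReal) ∂lam := by
          rw [integral_sub hintg (integrable_const _), ← hmp,
            mix_toReal _ _ (hc (measurableSet_singleton i)), integral_const, smul_eq_mul]
          simp [Measure.real, hw, lamb]
        have h2 : |w b * p i - w b * ((ν.1 : Measure X) (c ⁻¹' {i})).toReal| ≤ κ * w b := by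
          rw [h1, ← Real.norm_eq_abs]
          refine norm_setIntegral_le_of_norm_le_const (measure_lt_top _ _) fun ν' hν' => ?_
          rw [Real.norm_eq_abs]
          exact hqκ ν' ν ((show q ν' = b from hν').trans hν.symm) i
        rw [← mul_sub, abs_mul, abs_of_pos hpos, mul_comm] at h2
        exact le_of_mul_le_mul_right h2 hpos
      obtain ⟨h1, h2⟩ := hKp p hp0 hp1 hclose
      simp only [hmp]
      constructor
      · rw [Iu_smul _ _ hp1 _ (hK1 b)]
        rw [div_le_iff₀ hl2] at h1
        have := mul_le_mul_of_nonneg_left h1 hpos.le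
        linarith
      · simp only [mul_assoc, ← Finset.mul_sum] at h2 ⊢
        exact mul_le_mul_of_nonneg_left h2 hpos.le
  have hsum : ∑ b, mix (lamb b) = μ := by
    ext A hA
    rw [Measure.finsetSum_apply, hbar A hA]
    simp only [mix_apply _ _ hA]
    conv_rhs => rw [← sum_restrict_fiber lam q hq]
    rw [lintegral_finsetSum_measure]
  set A := ∑ b, Real.negMulLog (∑ i, (mix (lamb b) (c ⁻¹' {i})).toReal) with hA
  obtain ⟨k', hk'⟩ := exists_nat_gt (|A| / (Real.log 2 * L0 ^ d * (δ / 2)))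
  set k := k' + 1 with hkdef
  have hk : 0 < k := by omega
  have hkR : (1 : ℝ) ≤ k := by exact_mod_cast hk
  have hkR0 : (0 : ℝ) < k := by linarith
  have hAk : A / (Real.log 2 * (k * L0) ^ d) ≤ δ / 2 := by
    rw [div_lt_iff₀ (by positivity)] at hk'
    rw [div_le_iff₀ (by positivity), mul_pow]
    have h1 : (k : ℝ) ≤ (k : ℝ) ^ d := le_self_pow₀ hkR hd.ne'
    have h2 : (k' : ℝ) ≤ k := by simp [hkdef]
    have h3 : A ≤ |A| := le_abs_self A
    have h4 : (k' : ℝ) * (Real.log 2 * L0 ^ d * (δ / 2)) ≤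
        (k : ℝ) ^ d * (Real.log 2 * L0 ^ d * (δ / 2)) :=
      mul_le_mul_of_nonneg_right (h2.trans h1) (by positivity)
    linarith
  have hkL : 0 < k * L0 := by positivity
  have key := block_upper hT μ (fun b => mix (lamb b)) hsum (fun b => mix_inv hT _) L0 hL0 c hc x ε hx
    K hK0 hK1 k hk (k * L0) (8 * ε) hkL le_rfl (by
      rw [div_self hkL.ne', one_pow, one_mul]
      refine (Finset.sum_le_sum fun b _ => (hcell b).2).trans_lt ?_
      rw [← Finset.sum_mul, hw1]
      linarith)
  have hRD : RD d T μ (8 * ε) ≤ RL d T μ (k * L0) (8 * ε) / ENNReal.ofReal ((k * L0) ^ d) :=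
    iInf₂_le (k * L0) hkL
  refine hRD.trans ((ENNReal.div_le_div_right key _).trans ?_)
  rw [ofReal_div_pow _ _ hkL]
  have hbound : ((A + k ^ d * ∑ b, Iu (fun i => (mix (lamb b) (c ⁻¹' {i})).toReal) (K b)) /
      Real.log 2) / (k * L0) ^ d ≤ ∑ b, w b * (V b).toReal / L0 ^ d + δ := by
    have e1 : ∑ b, Iu (fun i => (mix (lamb b) (c ⁻¹' {i})).toReal) (K b) ≤
        Real.log 2 * (∑ b, w b * (V b).toReal + 2 * δ') := by
      refine (Finset.sum_le_sum fun b _ => (hcell b).1).trans ?_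
      rw [← Finset.mul_sum]
      refine le_of_eq (congrArg _ ?_)
      simp only [mul_add]
      rw [Finset.sum_add_distrib, ← Finset.sum_mul, hw1, one_mul]
    have e2 : ((A + k ^ d * ∑ b, Iu (fun i => (mix (lamb b) (c ⁻¹' {i})).toReal) (K b)) /
      Real.log 2) / (k * L0) ^ d ≤ ((A + k ^ d * (Real.log 2 * (∑ b, w b * (V b).toReal + 2 * δ'))) /
      Real.log 2) / (k * L0) ^ d := by gcongr
    refine e2.trans ?_
    have e3 : ((A + k ^ d * (Real.log 2 * (∑ b, w b * (V b).toReal + 2 * δ'))) /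
      Real.log 2) / (k * L0) ^ d = A / (Real.log 2 * (k * L0) ^ d) +
        ((∑ b, w b * (V b).toReal) / L0 ^ d + δ / 2) := by
      rw [hδ', mul_pow]; field_simp; ring
    rw [e3, ← Finset.sum_div]
    linarith
  refine (ENNReal.ofReal_le_ofReal hbound).trans ?_
  refine ENNReal.ofReal_add_le.trans (add_le_add_left ?_ _)
  rw [lintegral_finite_comp lam q hq (fun b => V b / ENNReal.ofReal (L0 ^ d)),
    ENNReal.ofReal_sum_of_nonneg (fun b _ => div_nonneg (mul_nonneg (hw0 b) ENNReal.toReal_nonneg)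
      hLd.le)]
  refine Finset.sum_le_sum fun b _ => ?_
  rw [← ofReal_div_pow _ _ hL0, ENNReal.ofReal_mul (hw0 b), mul_div_assoc]
  refine mul_le_mul' ENNReal.ofReal_toReal_le (ENNReal.div_le_div_right ENNReal.ofReal_toReal_le _)

end

end RDB

open MeasureTheory Filter Set
open scoped ENNReal Topology NNReal
set_option linter.unusedSectionVars false

namespace RDB

noncomputable section

variable {X : Type*} [MetricSpace X] [CompactSpace X] [MeasurableSpace X] [BorelSpace X]
variable {d : ℕ} {T : (Fin d → ℝ) → X → X}

theorem exists_G (hd : 0 < d) (hT : IsContAction d T) (ε : ℝ) (hε : 0 < ε) (Cb : ℝ≥0∞)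
    (hCbT : Cb ≠ ⊤)
    (hCb : ∀ᶠ L : ℝ in atTop, ∀ ν : InvM X d T,
      RL d T (ν.1 : Measure X) L ε / ENNReal.ofReal (L ^ d) ≤ Cb) :
    ∃ G : InvM X d T → ℝ≥0∞, Measurable G ∧ (∀ ν, RD d T (ν.1 : Measure X) (8 * ε) ≤ G ν) ∧
      (∀ ν, G ν ≤ RD d T (ν.1 : Measure X) (ε / 16)) ∧
      ∀ (lam : Measure (InvM X d T)) (_ : IsProbabilityMeasure lam)
        (μ : Measure X) (_ : IsProbabilityMeasure μ)
        (_ : ∀ A : Set X, MeasurableSet A → μ A = ∫⁻ ν, (ν.1 : Measure X) A ∂lam),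
        RD d T μ (8 * ε) ≤ ∫⁻ ν, G ν ∂lam := by
  obtain ⟨L1, hL1⟩ := eventually_atTop.1 hCb
  let Ls : ℕ → ℝ := fun n => max L1 1 + n
  have hLs : ∀ n, 0 < Ls n := fun n => by
    have : (1 : ℝ) ≤ max L1 1 := le_max_right _ _
    have h2 : (0 : ℝ) ≤ n := Nat.cast_nonneg n
    simp only [Ls]; linarith
  have hLs1 : ∀ n, L1 ≤ Ls n := fun n => by
    have : L1 ≤ max L1 1 := le_max_left _ _
    have h2 : (0 : ℝ) ≤ n := Nat.cast_nonneg n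
    simp only [Ls]; linarith
  have hLsT : Tendsto Ls atTop atTop :=
    tendsto_atTop_add_const_left _ _ tendsto_natCast_atTop_atTop
  let δ : ℕ → ℝ := fun n => 1 / ((n : ℝ) + 1)
  have hδ : ∀ n, 0 < δ n := fun n => Nat.one_div_pos_of_nat
  have hδ0 : Tendsto (fun n => ENNReal.ofReal (δ n)) atTop (𝓝 0) := by
    have := ENNReal.tendsto_ofReal (tendsto_one_div_add_atTop_nhds_zero_nat (𝕜 := ℝ))
    rw [ENNReal.ofReal_zero] at this
    exact this
  choose g hgm hg1 hg2 using fun n => exists_g (X := X) hd hT (Ls n) ε (δ n) (hLs n) hε (hδ n)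
  have hup : ∀ (lam : Measure (InvM X d T)) (_ : IsProbabilityMeasure lam)
        (μ : Measure X) (_ : IsProbabilityMeasure μ)
        (_ : ∀ A : Set X, MeasurableSet A → μ A = ∫⁻ ν, (ν.1 : Measure X) A ∂lam),
        RD d T μ (8 * ε) ≤ limsup (fun n => ∫⁻ ν, g n ν ∂lam) atTop := by
    intro lam hlam μ hμ hbar
    have h1 := ENNReal.limsup_add_of_right_tendsto_zero hδ0 (fun n => ∫⁻ ν, g n ν ∂lam)
    rw [← h1]
    refine le_limsup_of_le (by isBoundedDefault) fun b hb => ?_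
    obtain ⟨n, hn⟩ := hb.exists
    exact (hg2 n lam hlam μ hμ hbar).trans hn
  refine ⟨fun ν => limsup (fun n => g n ν) atTop, Measurable.limsup hgm, ?_, ?_, ?_⟩
  · intro ν
    have := hup (Measure.dirac ν) inferInstance (ν.1 : Measure X) inferInstance
      (fun A hA => (lintegral_dirac' ν (measurable_eval A hA)).symm)
    simp only [lintegral_dirac' ν (hgm _)] at this
    exact this
  · intro ν
    have h1 := limsup_RL_le hT (ν.1 : Measure X) ν.2 (ε / 16) (by positivity)
    rw [mul_div_cancel₀ _ (by norm_num : (16 : ℝ) ≠ 0)] at h1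
    refine le_trans ?_ h1
    refine le_trans (limsup_le_limsup (Eventually.of_forall fun n => hg1 n ν)
      (by isBoundedDefault) (by isBoundedDefault)) ?_
    have h2 := limsup_comp (fun L : ℝ => RL d T (ν.1 : Measure X) L ε / ENNReal.ofReal (L ^ d))
      Ls atTop
    refine (le_of_eq h2).trans ?_
    exact limsup_le_limsup_of_le hLsT (by isBoundedDefault) (by isBoundedDefault)
  · intro lam hlam μ hμ hbar
    refine (hup lam hlam μ hμ hbar).trans ?_
    refine limsup_lintegral_le (fun _ => Cb) hgm (fun n => Eventually.of_forall fun ν =>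
      (hg1 n ν).trans (hL1 _ (hLs1 n) ν)) (by simpa using hCbT)

theorem Iu_integral_le (lam : Measure (InvM X d T)) [IsProbabilityMeasure lam]
    (μ : Measure X) [IsProbabilityMeasure μ]
    {N : ℕ} (c : X → Fin N) (hc : Measurable c)
    (hpμ : ∀ i, (μ (c ⁻¹' {i})).toReal = ∫ ν, ((ν.1 : Measure X) (c ⁻¹' {i})).toReal ∂lam)
    (K : Fin N → Fin N → ℝ) (hK0 : ∀ i s, 0 ≤ K i s) (hK1 : ∀ i, ∑ s, K i s = 1) :
    Integrable (fun ν : InvM X d T =>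
      Iu (fun i => ((ν.1 : Measure X) (c ⁻¹' {i})).toReal) K) lam ∧
    ∫ ν, Iu (fun i => ((ν.1 : Measure X) (c ⁻¹' {i})).toReal) K ∂lam ≤
      Iu (fun i => (μ (c ⁻¹' {i})).toReal) K := by
  set p : InvM X d T → Fin N → ℝ := fun ν i => ((ν.1 : Measure X) (c ⁻¹' {i})).toReal with hp
  have hpm : ∀ i, Measurable fun ν => p ν i := fun i =>
    (measurable_eval _ (hc (measurableSet_singleton i))).ennreal_toReal
  have hp0 : ∀ ν i, 0 ≤ p ν i := fun ν i => ENNReal.toReal_nonneg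
  have hp1 : ∀ ν, ∑ i, p ν i = 1 := fun ν => sum_fiber_one (ν.1 : Measure X) c hc
  have hple : ∀ ν i, p ν i ≤ 1 := fun ν i => measureReal_le_one (μ := (ν.1 : Measure X))
  have hpint : ∀ i, Integrable (fun ν => p ν i) lam := fun i =>
    Integrable.of_bound (C := 1) (hpm i).aestronglyMeasurable (Eventually.of_forall fun ν => by
      rw [Real.norm_eq_abs, abs_of_nonneg (hp0 ν i)]; exact hple ν i)
  set r : InvM X d T → Fin N → ℝ := fun ν s => ∑ i, p ν i * K i s with hr
  have hrint : ∀ s, Integrable (fun ν => r ν s) lam := fun s =>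
    integrable_finsetSum _ fun i _ => (hpint i).mul_const _
  have hrm : ∀ s, Measurable fun ν => r ν s := fun s =>
    Finset.measurable_fun_sum _ fun i _ => (hpm i).mul_const _
  have hr0 : ∀ ν s, 0 ≤ r ν s := fun ν s => Finset.sum_nonneg fun i _ =>
    mul_nonneg (hp0 ν i) (hK0 i s)
  have hrs : ∀ ν, ∑ s, r ν s = 1 := fun ν => by
    simp only [hr]; rw [Finset.sum_comm]; simp only [← Finset.mul_sum, hK1, mul_one, hp1]
  have hr1 : ∀ ν s, r ν s ≤ 1 := fun ν s => by
    rw [← hrs ν]; exact Finset.single_le_sum (fun s _ => hr0 ν s) (Finset.mem_univ s)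
  obtain ⟨C, hC⟩ := isCompact_Icc.exists_bound_of_continuousOn
    (f := Real.negMulLog) (s := Set.Icc (0 : ℝ) 1) Real.continuous_negMulLog.continuousOn
  have hnint : ∀ s, Integrable (fun ν => Real.negMulLog (r ν s)) lam := fun s =>
    Integrable.of_bound (C := C)
      (Real.continuous_negMulLog.measurable.comp (hrm s)).aestronglyMeasurable
      (Eventually.of_forall fun ν => hC _ ⟨hr0 ν s, hr1 ν s⟩)
  have hIu : (fun ν => Iu (p ν) K) = fun ν => ∑ s, Real.negMulLog (r ν s) -
      ∑ i, p ν i * Hn (K i) := by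
    ext ν
    rw [Iu, hp1, Real.negMulLog_one, sub_zero]; rfl
  have hi1 : Integrable (fun ν => ∑ s, Real.negMulLog (r ν s)) lam :=
    integrable_finsetSum _ fun s _ => hnint s
  have hi2 : Integrable (fun ν => ∑ i, p ν i * Hn (K i)) lam :=
    integrable_finsetSum _ fun i _ => (hpint i).mul_const _
  have hfun : ∀ ν, Iu (fun i => ((ν.1 : Measure X) (c ⁻¹' {i})).toReal) K = Iu (p ν) K :=
    fun ν => rfl
  change Integrable (fun ν => Iu (p ν) K) lam ∧ ∫ ν, (fun ν => Iu (p ν) K) ν ∂lam ≤ _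
  rw [hIu]
  refine ⟨hi1.sub hi2, ?_⟩
  rw [integral_sub hi1 hi2, integral_finsetSum _ (fun s _ => hnint s),
    integral_finsetSum _ (fun i _ => (hpint i).mul_const _), Iu, sum_fiber_one μ c hc,
    Real.negMulLog_one, sub_zero]
  refine sub_le_sub ?_ (le_of_eq ?_)
  · refine Finset.sum_le_sum fun s _ => ?_
    refine (Real.concaveOn_negMulLog.le_map_integral Real.continuous_negMulLog.continuousOn
      isClosed_Ici (Eventually.of_forall fun ν => hr0 ν s) (hrint s) (hnint s)).trans ?_
    refine le_of_eq (congrArg _ ?_)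
    simp only [hr]
    rw [integral_finsetSum _ (fun i _ => (hpint i).mul_const _)]
    exact Finset.sum_congr rfl fun i _ => by rw [integral_mul_const, hpμ]
  · exact Finset.sum_congr rfl fun i _ => by rw [integral_mul_const, hpμ]

theorem lower_bound (hT : IsContAction d T) (lam : Measure (InvM X d T)) [IsProbabilityMeasure lam]
    (μ : Measure X) [IsProbabilityMeasure μ]
    (hbar : ∀ A : Set X, MeasurableSet A → μ A = ∫⁻ ν, (ν.1 : Measure X) A ∂lam)
    (ε : ℝ) (hε : 0 < ε) (M : ℕ) (hM : 0 < M) (S : ℝ≥0∞) (G : InvM X d T → ℝ≥0∞)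
    (hG1 : ∀ ν, G ν ≤ RD d T (ν.1 : Measure X) (8 * M * ε))
    (hG2 : ∀ ν, G ν ≤ S) :
    ∫⁻ ν, G ν ∂lam ≤ RD d T μ ε + S * (M : ℝ≥0∞)⁻¹ := by
  have hne : Nonempty X := μ.nonempty_of_neZero
  have hl2 : 0 < Real.log 2 := Real.log_pos (by norm_num)
  have hMR : (1 : ℝ) ≤ M := by exact_mod_cast hM
  rw [← tsub_le_iff_right]
  refine le_iInf₂ fun L hL => ?_
  have hLd : 0 < L ^ d := pow_pos hL d
  have hp : ENNReal.ofReal (L ^ d) ≠ 0 := by simpa using hLd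
  rw [ENNReal.le_div_iff_mul_le (Or.inl hp) (Or.inl ENNReal.ofReal_ne_top)]
  refine le_of_forall_gt_imp_ge_of_dense fun a ha => ?_
  rw [← ENNReal.le_div_iff_mul_le (Or.inl hp) (Or.inl ENNReal.ofReal_ne_top), tsub_le_iff_right]
  obtain ⟨N, c, hc, x, hx⟩ : ∃ N : ℕ, ∃ c : X → Fin N, Measurable c ∧ ∃ x : Fin N → X,
      ∀ y, ∀ u ∈ unitBox d L, dist (T u y) (T u (x (c y))) ≤ ε := ⟨_, exists_cells hT L ε hε⟩
  obtain ⟨K, hK0, hK1, hKI, hKD⟩ := exists_kernel_of_RL_lt hT μ L ε ε hL c hc x hx a ha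
  have hpμ : ∀ i, (μ (c ⁻¹' {i})).toReal = ∫ ν, ((ν.1 : Measure X) (c ⁻¹' {i})).toReal ∂lam := by
    intro i
    have hA := hc (measurableSet_singleton i)
    rw [hbar _ hA, ← mix_apply _ _ hA, mix_toReal _ _ hA]
  obtain ⟨hintg, hle⟩ := Iu_integral_le lam μ c hc hpμ K hK0 hK1
  set p : InvM X d T → Fin N → ℝ := fun ν i => ((ν.1 : Measure X) (c ⁻¹' {i})).toReal with hpdef
  set ρ : Fin N → Fin N → ℝ := fun i s => Dn d T L (x i) (fun u => T u (x s)) with hρ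
  have hρ0 : ∀ i s, 0 ≤ ρ i s := fun i s => Dn_nonneg L hL.le _ _
  have hpm : ∀ i, Measurable fun ν => p ν i := fun i =>
    (measurable_eval _ (hc (measurableSet_singleton i))).ennreal_toReal
  have hp0 : ∀ ν i, 0 ≤ p ν i := fun ν i => ENNReal.toReal_nonneg
  have hp1 : ∀ ν, ∑ i, p ν i = 1 := fun ν => sum_fiber_one (ν.1 : Measure X) c hc
  have hple : ∀ ν i, p ν i ≤ 1 := fun ν i => measureReal_le_one (μ := (ν.1 : Measure X))
  have hpint : ∀ i, Integrable (fun ν => p ν i) lam := fun i =>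
    Integrable.of_bound (C := 1) (hpm i).aestronglyMeasurable (Eventually.of_forall fun ν => by
      rw [Real.norm_eq_abs, abs_of_nonneg (hp0 ν i)]; exact hple ν i)
  set D : InvM X d T → ℝ := fun ν => ∑ i, ∑ s, p ν i * K i s * ρ i s with hD
  have hDm : Measurable D := Finset.measurable_fun_sum _ fun i _ =>
    Finset.measurable_fun_sum _ fun s _ => ((hpm i).mul_const _).mul_const _
  have hDint : Integrable D lam := integrable_finsetSum _ fun i _ =>
    integrable_finsetSum _ fun s _ => ((hpint i).mul_const _).mul_const _
  have hD0 : ∀ ν, 0 ≤ D ν := fun ν => Finset.sum_nonneg fun i _ => Finset.sum_nonneg fun s _ =>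
    mul_nonneg (mul_nonneg (hp0 _ _) (hK0 _ _)) (hρ0 _ _)
  have hDμ : ∫ ν, D ν ∂lam < 4 * ε := by
    have : ∫ ν, D ν ∂lam = ∑ i, ∑ s, (μ (c ⁻¹' {i})).toReal * K i s * ρ i s := by
      simp only [hD]
      rw [integral_finsetSum _ (fun i _ => integrable_finsetSum _ fun s _ =>
        ((hpint i).mul_const _).mul_const _)]
      refine Finset.sum_congr rfl fun i _ => ?_
      rw [integral_finsetSum _ (fun s _ => ((hpint i).mul_const _).mul_const _)]
      refine Finset.sum_congr rfl fun s _ => ?_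
      rw [integral_mul_const, integral_mul_const, hpμ]
    rw [this]; linarith
  set E : Set (InvM X d T) := {ν | 4 * M * ε ≤ D ν} with hE
  have hEm : MeasurableSet E := measurableSet_le measurable_const hDm
  have hElam : lam E ≤ (M : ℝ≥0∞)⁻¹ := by
    have h1 := mul_meas_ge_le_integral_of_nonneg (Eventually.of_forall hD0) hDint (4 * M * ε)
    have h2 : lam.real E ≤ (M : ℝ)⁻¹ := by
      have h3 : M * lam.real E ≤ 1 := by
        have : 4 * ε * (M * lam.real E) ≤ 4 * ε * 1 := by
          change 4 * M * ε * lam.real E ≤ _ at h1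
          nlinarith
        exact le_of_mul_le_mul_left this (by positivity)
      rw [← one_div, le_div_iff₀ (by linarith)]; linarith
    have h4 : lam E = ENNReal.ofReal (lam.real E) := (ofReal_measureReal).symm
    rw [h4]
    refine (ENNReal.ofReal_le_ofReal h2).trans ?_
    rw [ENNReal.ofReal_inv_of_pos (by linarith), ENNReal.ofReal_natCast]
  have hI0 : ∀ ν, 0 ≤ Iu (p ν) K := fun ν => Iu_nonneg _ (hp0 ν) (hp1 ν) K hK0
  have hpt : ∀ ν, G ν ≤ ENNReal.ofReal (Iu (p ν) K) * (ENNReal.ofReal (Real.log 2 * L ^ d))⁻¹ +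
      E.indicator (fun _ => S) ν := by
    intro ν
    by_cases hν : ν ∈ E
    · rw [indicator_of_mem hν]
      exact (hG2 ν).trans le_add_self
    · rw [indicator_of_notMem hν, add_zero]
      have hDν : D ν < 4 * M * ε := not_le.1 hν
      refine (hG1 ν).trans ((iInf₂_le L hL).trans ?_)
      have key := block_upper hT (ν.1 : Measure X) (B := Unit) (fun _ => (ν.1 : Measure X)) (by simp)
        (fun _ => ν.2) L hL c hc x ε hx (fun _ => K) (fun _ => hK0) (fun _ => hK1) 1 one_pos L
        (8 * M * ε) hL (by simp) (by
          simp only [Finset.univ_unique, Finset.sum_singleton, Nat.cast_one, one_mul,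
            div_self hL.ne', one_pow]
          have e2 : ∀ i, ∑ s, p ν i * (K i s * (ε + ρ i s)) = p ν i * ε +
              ∑ s, p ν i * K i s * ρ i s := by
            intro i
            have e3 : p ν i * ε = ∑ s, p ν i * ε * K i s := by
              rw [← Finset.mul_sum, hK1, mul_one]
            rw [e3, ← Finset.sum_add_distrib]
            exact Finset.sum_congr rfl fun s _ => by ring
          change ∑ i, ∑ s, p ν i * (K i s * (ε + ρ i s)) < _
          simp only [e2]
          rw [Finset.sum_add_distrib, ← Finset.sum_mul, hp1, one_mul]
          change ε + D ν < _
          nlinarith)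
      simp only [Finset.univ_unique, Finset.sum_singleton, sum_fiber_one (ν.1 : Measure X) c hc,
        Real.negMulLog_one, zero_add, Nat.cast_one, one_pow, one_mul] at key
      refine (ENNReal.div_le_div_right key _).trans (le_of_eq ?_)
      rw [ofReal_div_pow _ _ hL, ← ENNReal.ofReal_inv_of_pos (by positivity),
        ← ENNReal.ofReal_mul (hI0 ν), div_div, div_eq_mul_inv]
  refine (lintegral_mono hpt).trans ?_
  rw [lintegral_add_right _ (measurable_const.indicator hEm), lintegral_indicator_const hEm,
    lintegral_mul_const' _ _ (ENNReal.inv_ne_top.2 (by simpa using by positivity)),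
    ← ofReal_integral_eq_lintegral_ofReal hintg (Eventually.of_forall hI0)]
  refine add_le_add ?_ (mul_le_mul_right hElam S)
  have h5 : ENNReal.ofReal (∫ ν, Iu (p ν) K ∂lam) * (ENNReal.ofReal (Real.log 2 * L ^ d))⁻¹ ≤
      ENNReal.ofReal (Iu (fun i => (μ (c ⁻¹' {i})).toReal) K) *
        (ENNReal.ofReal (Real.log 2 * L ^ d))⁻¹ := by gcongr
  refine h5.trans ?_
  have h6 : ENNReal.ofReal (Iu (fun i => (μ (c ⁻¹' {i})).toReal) K) *
        (ENNReal.ofReal (Real.log 2 * L ^ d))⁻¹ =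
      ENNReal.ofReal (Iu (fun i => (μ (c ⁻¹' {i})).toReal) K / Real.log 2) /
        ENNReal.ofReal (L ^ d) := by
    rw [ofReal_div_pow _ _ hL, ← ENNReal.ofReal_inv_of_pos (by positivity),
        ← ENNReal.ofReal_mul (Iu_nonneg _ (fun _ => ENNReal.toReal_nonneg) (sum_fiber_one μ c hc)
          K hK0), div_div, div_eq_mul_inv]
  rw [h6]
  exact ENNReal.div_le_div_right hKI _

end

end RDB

open MeasureTheory Filter Set
open scoped ENNReal Topology NNReal
set_option linter.unusedSectionVars false

namespace RDB

noncomputable section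

theorem tendsto_half_pow : Tendsto (fun k : ℕ => (1 / 2 : ℝ) ^ k) atTop (𝓝[>] 0) := by
  refine tendsto_nhdsWithin_iff.2 ⟨tendsto_pow_atTop_nhds_zero_of_lt_one (by norm_num) (by norm_num),
    Eventually.of_forall fun k => ?_⟩
  exact pow_pos (by norm_num : (0 : ℝ) < 1 / 2) k

theorem logb_half_pow (k : ℕ) : ENNReal.ofReal (Real.logb 2 (1 / (1 / 2 : ℝ) ^ k)) = k := by
  have : (1 / (1 / 2 : ℝ) ^ k) = 2 ^ k := by simp
  rw [this, Real.logb_pow, Real.logb_self_eq_one (by norm_num), mul_one, ENNReal.ofReal_natCast]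

theorem logb_atTop : Tendsto (fun ε : ℝ => Real.logb 2 (1 / ε)) (𝓝[>] 0) atTop := by
  refine (Real.tendsto_logb_atTop (by norm_num)).comp ?_
  have h : (fun ε : ℝ => 1 / ε) = fun ε => ε⁻¹ := by ext; simp
  change Tendsto (fun ε : ℝ => 1 / ε) _ _
  rw [h]
  exact tendsto_inv_nhdsGT_zero (𝕜 := ℝ)

theorem pow_le_eps (ε : ℝ) (hε : 0 < ε) (k : ℕ) (h : Real.logb 2 (1 / ε) ≤ k) :
    (1 / 2 : ℝ) ^ k ≤ ε := by
  rw [Real.logb_le_iff_le_rpow (by norm_num) (by positivity), Real.rpow_natCast] at h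
  rw [one_div, inv_pow]
  rw [one_div] at h
  exact inv_le_of_inv_le₀ hε h

theorem eps_le_pow (ε : ℝ) (hε : 0 < ε) (k : ℕ) (h : (k : ℝ) ≤ Real.logb 2 (1 / ε)) :
    ε ≤ (1 / 2 : ℝ) ^ k := by
  rw [Real.le_logb_iff_rpow_le (by norm_num) (by positivity), Real.rpow_natCast] at h
  rw [one_div, inv_pow]
  rw [one_div] at h
  exact le_inv_of_le_inv₀ (by positivity) h

/-- discretisation of the upper limit -/
theorem limsup_le_of_seq (F : ℝ → ℝ≥0∞) (hF : Antitone F) (c : ℝ≥0∞) (hc : c ≠ ⊤) (b : ℕ)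
    (h : ∀ᶠ k : ℕ in atTop, F ((1 / 2 : ℝ) ^ k) ≤ c * (k + b)) :
    limsup (fun ε : ℝ => F ε / ENNReal.ofReal (Real.logb 2 (1 / ε))) (𝓝[>] 0) ≤ c := by
  obtain ⟨k0, hk0⟩ := eventually_atTop.1 h
  have hlim : Tendsto (fun ε : ℝ => c * ENNReal.ofReal (1 + (1 + b) / Real.logb 2 (1 / ε)))
      (𝓝[>] 0) (𝓝 c) := by
    have h1 : Tendsto (fun ε : ℝ => 1 + (1 + (b : ℝ)) / Real.logb 2 (1 / ε)) (𝓝[>] 0)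
        (𝓝 (1 + 0)) := tendsto_const_nhds.add (tendsto_const_nhds.div_atTop logb_atTop)
    have h2 := ENNReal.Tendsto.const_mul (a := c) (ENNReal.tendsto_ofReal h1) (Or.inr hc)
    simpa using h2
  rw [← hlim.limsup_eq]
  refine limsup_le_limsup ?_
  filter_upwards [self_mem_nhdsWithin, logb_atTop.eventually_ge_atTop ((k0 : ℝ) + 1)] with ε hε hl
  have hε : 0 < ε := hε
  set l := Real.logb 2 (1 / ε) with hldef
  have hl0 : 0 < l := by have : (0 : ℝ) ≤ k0 := Nat.cast_nonneg _; linarith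
  have hk : k0 ≤ ⌈l⌉₊ := by
    have : (k0 : ℝ) ≤ ⌈l⌉₊ := by have := Nat.le_ceil l; linarith
    exact_mod_cast this
  have h1 : F ε ≤ c * ENNReal.ofReal (l + 1 + b) := by
    refine (hF (pow_le_eps ε hε ⌈l⌉₊ (Nat.le_ceil l))).trans ((hk0 _ hk).trans ?_)
    gcongr
    have h3 : ((⌈l⌉₊ : ℝ≥0∞) + b) = ENNReal.ofReal ((⌈l⌉₊ : ℝ) + b) := by
      rw [ENNReal.ofReal_add (by positivity) (by positivity)]; simp
    rw [h3]
    apply ENNReal.ofReal_le_ofReal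
    have := Nat.ceil_lt_add_one hl0.le
    linarith
  refine (ENNReal.div_le_div_right h1 _).trans (le_of_eq ?_)
  rw [mul_div_assoc, ← ENNReal.ofReal_div_of_pos hl0]
  congr 2
  field_simp
  ring

theorem freq_of_liminf_lt (F : ℝ → ℝ≥0∞) (hF : Antitone F) (c : ℝ≥0∞)
    (h : liminf (fun ε : ℝ => F ε / ENNReal.ofReal (Real.logb 2 (1 / ε))) (𝓝[>] 0) < c) :
    ∃ᶠ k : ℕ in atTop, F ((1 / 2 : ℝ) ^ k) ≤ c * (k + 1) := by
  have h1 := frequently_lt_of_liminf_lt (by isBoundedDefault) h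
  rw [frequently_atTop]
  intro n
  obtain ⟨ε, hε1, hε2, hε⟩ := (h1.and_eventually
    ((logb_atTop.eventually_ge_atTop ((n : ℝ) + 1)).and self_mem_nhdsWithin)).exists
  have hε : 0 < ε := hε
  set l := Real.logb 2 (1 / ε) with hldef
  have hl0 : 0 < l := by have : (0 : ℝ) ≤ n := Nat.cast_nonneg _; linarith
  refine ⟨⌊l⌋₊, ?_, ?_⟩
  · exact Nat.le_floor (by linarith)
  · have h2 : F ε ≤ c * ENNReal.ofReal l := by
      rw [ENNReal.div_lt_iff (Or.inl (by simpa using hl0)) (Or.inl ENNReal.ofReal_ne_top)] at hε1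
      exact hε1.le
    refine (hF (eps_le_pow ε hε ⌊l⌋₊ (Nat.floor_le hl0.le))).trans (h2.trans ?_)
    gcongr
    have h3 : ((⌊l⌋₊ : ℝ≥0∞) + 1) = ENNReal.ofReal ((⌊l⌋₊ : ℝ) + 1) := by
      rw [ENNReal.ofReal_add (by positivity) (by positivity)]; simp
    rw [h3]
    exact ENNReal.ofReal_le_ofReal (Nat.lt_floor_add_one l).le

theorem limsup_seq_le (F : ℝ → ℝ≥0∞) (a : ℕ) :
    limsup (fun k : ℕ => F ((1 / 2 : ℝ) ^ (k + a)) / ((k + a : ℕ) : ℝ≥0∞)) atTop ≤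
    limsup (fun ε : ℝ => F ε / ENNReal.ofReal (Real.logb 2 (1 / ε))) (𝓝[>] 0) := by
  have h : Tendsto (fun k : ℕ => (1 / 2 : ℝ) ^ (k + a)) atTop (𝓝[>] 0) :=
    tendsto_half_pow.comp (tendsto_add_atTop_nat a)
  have := limsup_le_limsup_of_le (f := map (fun k : ℕ => (1 / 2 : ℝ) ^ (k + a)) atTop) h
    (u := fun ε : ℝ => F ε / ENNReal.ofReal (Real.logb 2 (1 / ε)))
  rw [← limsup_comp] at this
  refine le_trans (le_of_eq ?_) this
  congr 1
  ext k
  simp only [Function.comp, logb_half_pow]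

theorem le_liminf_seq (F : ℝ → ℝ≥0∞) (a : ℕ) :
    liminf (fun ε : ℝ => F ε / ENNReal.ofReal (Real.logb 2 (1 / ε))) (𝓝[>] 0) ≤
    liminf (fun k : ℕ => F ((1 / 2 : ℝ) ^ (k + a)) / ((k + a : ℕ) : ℝ≥0∞)) atTop := by
  have h : Tendsto (fun k : ℕ => (1 / 2 : ℝ) ^ (k + a)) atTop (𝓝[>] 0) :=
    tendsto_half_pow.comp (tendsto_add_atTop_nat a)
  have := liminf_le_liminf_of_le (g := map (fun k : ℕ => (1 / 2 : ℝ) ^ (k + a)) atTop) h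
    (u := fun ε : ℝ => F ε / ENNReal.ofReal (Real.logb 2 (1 / ε)))
  rw [← liminf_comp] at this
  refine le_trans this (le_of_eq ?_)
  congr 1
  ext k
  simp only [Function.comp, logb_half_pow]

variable {X : Type*} [MetricSpace X] [CompactSpace X] [MeasurableSpace X] [BorelSpace X]
variable {d : ℕ} {T : (Fin d → ℝ) → X → X}

theorem RD_anti (ν : Measure X) : Antitone (RD d T ν) := by
  intro a b hab
  unfold RD RL
  refine iInf_mono fun L => iInf_mono fun _ => ENNReal.div_le_div_right ?_ _
  refine iInf_mono fun Ω => iInf_mono fun _ => iInf_mono fun P => iInf_mono fun _ =>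
    iInf_mono fun Xv => iInf_mono fun Yv => iInf_mono fun _ => iInf_mono fun _ =>
    iInf_mono fun _ => ?_
  exact le_iInf fun h => iInf_le _ (h.trans_le hab)

theorem uniform_bound (hT : IsContAction d T) (hdim : umdim d T ≠ ⊤) :
    ∃ C : ℝ≥0∞, C ≠ ⊤ ∧ ∃ k0 : ℕ, ∀ k ≥ k0, ∀ᶠ L : ℝ in atTop,
      ∀ (ν : Measure X) (_ : IsProbabilityMeasure ν),
        RL d T ν L ((1 / 2 : ℝ) ^ k) / ENNReal.ofReal (L ^ d) ≤ C * (k + 1) := by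
  have h1 : umdim d T < umdim d T + 1 := ENNReal.lt_add_right hdim one_ne_zero
  set C := umdim d T + 1 with hC
  have hCT : C ≠ ⊤ := by simp [hC, hdim]
  have h2 := tendsto_half_pow.eventually (eventually_lt_of_limsup_lt (h1 : limsup _ _ < _))
  obtain ⟨k0, hk0⟩ := eventually_atTop.1 h2
  refine ⟨C, hCT, k0 + 1, fun k hk => ?_⟩
  have h3 := hk0 (k + 1) (by omega)
  rw [logb_half_pow] at h3
  have h4 : entScale d T ((1 / 2 : ℝ) ^ (k + 1)) < C * (k + 1) := by
    rw [ENNReal.div_lt_iff (Or.inl (by simp)) (Or.inl (by simp))] at h3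
    simpa using h3
  filter_upwards [eventually_lt_of_limsup_lt (h4 : limsup _ _ < _), eventually_gt_atTop 0]
    with L hL hL0 ν _
  have h5 := RL_le_covNum hT ν L ((1 / 2 : ℝ) ^ (k + 1)) hL0 (by positivity)
  have h6 : 2 * (1 / 2 : ℝ) ^ (k + 1) = (1 / 2 : ℝ) ^ k := by rw [pow_succ]; ring
  rw [h6] at h5
  refine (ENNReal.div_le_div_right h5 _).trans ?_
  rw [ofReal_div_pow _ _ hL0]
  exact hL.le

theorem RD_le_of_eventually (ν : Measure X) (ε : ℝ) (B : ℝ≥0∞)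
    (h : ∀ᶠ L : ℝ in atTop, RL d T ν L ε / ENNReal.ofReal (L ^ d) ≤ B) : RD d T ν ε ≤ B := by
  obtain ⟨L, hL, hL0⟩ := (h.and (eventually_gt_atTop 0)).exists
  exact (iInf₂_le L hL0).trans hL

/-- If `c k ≤ A k + B` for infinitely many `k`, then `c ≤ A`. -/
theorem le_of_freq (c A B : ℝ≥0∞) (hB : B ≠ ⊤)
    (h : ∃ᶠ k : ℕ in atTop, c * k ≤ A * k + B) : c ≤ A := by
  have hlim : Tendsto (fun k : ℕ => A + B / k) atTop (𝓝 (A + 0)) :=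
    tendsto_const_nhds.add (ENNReal.Tendsto.const_div ENNReal.tendsto_nat_nhds_top (Or.inr hB)
      |>.trans (by simp))
  rw [add_zero] at hlim
  refine ge_of_tendsto_of_frequently hlim ?_
  refine (h.and_eventually (eventually_gt_atTop 0)).mono fun k hk => ?_
  obtain ⟨h1, h2⟩ := hk
  have hk0 : (k : ℝ≥0∞) ≠ 0 := by simpa using h2.ne'
  have hkT : (k : ℝ≥0∞) ≠ ⊤ := ENNReal.natCast_ne_top k
  calc c = c * k / k := (ENNReal.mul_div_cancel_right hk0 hkT).symm
    _ ≤ (A * k + B) / k := ENNReal.div_le_div_right h1 _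
    _ = A + B / k := by rw [ENNReal.add_div, ENNReal.mul_div_cancel_right hk0 hkT]

end

end RDB

open MeasureTheory Filter Set
open scoped ENNReal Topology NNReal
set_option linter.unusedSectionVars false

namespace RDB

noncomputable section

variable {X : Type*} [MetricSpace X] [CompactSpace X] [MeasurableSpace X] [BorelSpace X]
variable {d : ℕ} {T : (Fin d → ℝ) → X → X}

/-- The measurable comparison functions along a dyadic sequence of scales. -/
theorem exists_seq (hd : 0 < d) (hT : IsContAction d T) (hdim : umdim d T ≠ ⊤) :
    ∃ (C : ℝ≥0∞) (_ : C ≠ ⊤) (q : ℕ) (_ : 0 < q) (G : ℕ → InvM X d T → ℝ≥0∞),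
      (∀ n, Measurable (G n)) ∧
      (∀ n ν, RD d T ν.1 ((1 / 2 : ℝ) ^ (n + q)) ≤ G n ν) ∧
      (∀ n ν, G n ν ≤ RD d T ν.1 ((1 / 2 : ℝ) ^ (n + (q + 7)))) ∧
      (∀ n ν, G n ν ≤ C * ((n + (q + 7) : ℕ) : ℝ≥0∞)) ∧
      ∀ n (lam : Measure (InvM X d T)) (_ : IsProbabilityMeasure lam)
        (μ : Measure X) (_ : IsProbabilityMeasure μ)
        (_ : ∀ A : Set X, MeasurableSet A → μ A = ∫⁻ ν, (ν.1 : Measure X) A ∂lam),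
        RD d T μ ((1 / 2 : ℝ) ^ (n + q)) ≤ ∫⁻ ν, G n ν ∂lam := by
  obtain ⟨C, hC, k0, hk0⟩ := uniform_bound (X := X) hT hdim
  have key := fun n : ℕ => exists_G (X := X) hd hT ((1 / 2 : ℝ) ^ (n + (k0 + 1) + 3))
    (by positivity) (C * (((n + (k0 + 1) + 3 : ℕ) : ℝ≥0∞) + 1))
    (ENNReal.mul_ne_top hC (by finiteness)) (by
      filter_upwards [hk0 (n + (k0 + 1) + 3) (by omega)] with L hL ν
      exact hL _ inferInstance)
  choose G hG1 hG2 hG3 hG4 using key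
  have e1 : ∀ n : ℕ, 8 * (1 / 2 : ℝ) ^ (n + (k0 + 1) + 3) = (1 / 2 : ℝ) ^ (n + (k0 + 1)) :=
    fun n => by rw [pow_add _ _ 3]; ring
  have e2 : ∀ n : ℕ, (1 / 2 : ℝ) ^ (n + (k0 + 1) + 3) / 16 =
      (1 / 2 : ℝ) ^ (n + (k0 + 1 + 7)) :=
    fun n => by
      rw [show n + (k0 + 1 + 7) = n + (k0 + 1) + 3 + 4 by ring, pow_add _ _ 4]; ring
  simp only [e1, e2] at hG2 hG3 hG4
  refine ⟨2 * C, ENNReal.mul_ne_top (by simp) hC, k0 + 1, by omega, G, hG1, hG2, hG3,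
    fun n ν => ?_, hG4⟩
  refine (hG3 n ν).trans ?_
  refine (RD_le_of_eventually _ _ (C * (((n + (k0 + 1 + 7) : ℕ) : ℝ≥0∞) + 1)) ?_).trans ?_
  · filter_upwards [hk0 (n + (k0 + 1 + 7)) (by omega)] with L hL
    exact hL _ inferInstance
  · rw [mul_comm 2 C, mul_assoc]
    gcongr
    exact_mod_cast (by omega : n + (k0 + 1 + 7) + 1 ≤ 2 * (n + (k0 + 1 + 7)))

theorem main_upper (hd : 0 < d) (hT : IsContAction d T) (hdim : umdim d T ≠ ⊤)
    (lam : Measure (InvM X d T)) [IsProbabilityMeasure lam]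
    (μ : Measure X) [IsProbabilityMeasure μ]
    (hbar : ∀ A : Set X, MeasurableSet A → μ A = ∫⁻ ν, (ν.1 : Measure X) A ∂lam) :
    urdim d T μ ≤ ∫⁻ ν, urdim d T (ν.1 : Measure X) ∂lam := by
  obtain ⟨C, hC, q, hq, G, hGm, hG1, hG2, hG3, hG4⟩ := exists_seq (X := X) hd hT hdim
  have hlim : limsup (fun n => ∫⁻ ν, G n ν / ((n + (q + 7) : ℕ) : ℝ≥0∞) ∂lam) atTop ≤
      ∫⁻ ν, urdim d T (ν.1 : Measure X) ∂lam := by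
    refine (limsup_lintegral_le (fun _ => C) (fun n => (hGm n).div_const _)
      (fun n => Eventually.of_forall fun ν => ?_) (by simpa using hC)).trans ?_
    · exact ENNReal.div_le_of_le_mul (hG3 n ν)
    · refine lintegral_mono fun ν => ?_
      refine le_trans (limsup_le_limsup (Eventually.of_forall fun n => ?_))
        (limsup_seq_le (RD d T (ν.1 : Measure X)) (q + 7))
      exact ENNReal.div_le_div_right (hG2 n ν) _
  refine le_of_forall_gt_imp_ge_of_dense fun c hc => ?_
  rcases eq_or_ne c ⊤ with rfl | hcT
  · exact le_top
  refine limsup_le_of_seq _ (RD_anti μ) c hcT 7 ?_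
  have h1 := eventually_lt_of_limsup_lt (hlim.trans_lt hc)
  obtain ⟨n0, hn0⟩ := eventually_atTop.1 h1
  refine eventually_atTop.2 ⟨n0 + q, fun k hk => ?_⟩
  obtain ⟨n, rfl⟩ : ∃ n, k = n + q := ⟨k - q, by omega⟩
  refine (hG4 n lam inferInstance μ inferInstance hbar).trans ?_
  have h2 := hn0 n (by omega)
  simp only [div_eq_mul_inv] at h2
  rw [lintegral_mul_const _ (hGm n), ← div_eq_mul_inv, ENNReal.div_lt_iff (Or.inl (by simp))
    (Or.inl (ENNReal.natCast_ne_top _))] at h2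
  refine h2.le.trans (le_of_eq ?_)
  push_cast
  ring

theorem main_lower (hd : 0 < d) (hT : IsContAction d T) (hdim : umdim d T ≠ ⊤)
    (lam : Measure (InvM X d T)) [IsProbabilityMeasure lam]
    (μ : Measure X) [IsProbabilityMeasure μ]
    (hbar : ∀ A : Set X, MeasurableSet A → μ A = ∫⁻ ν, (ν.1 : Measure X) A ∂lam) :
    ∫⁻ ν, lrdim d T (ν.1 : Measure X) ∂lam ≤ lrdim d T μ := by
  obtain ⟨C, hC, q, hq, G, hGm, hG1, hG2, hG3, hG4⟩ := exists_seq (X := X) hd hT hdim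
  have hlim : ∫⁻ ν, lrdim d T (ν.1 : Measure X) ∂lam ≤
      liminf (fun n => ∫⁻ ν, G n ν / ((n + q : ℕ) : ℝ≥0∞) ∂lam) atTop := by
    refine le_trans ?_ (lintegral_liminf_le fun n => (hGm n).div_const _)
    refine lintegral_mono fun ν => ?_
    refine (le_liminf_seq (RD d T (ν.1 : Measure X)) q).trans
      (liminf_le_liminf (Eventually.of_forall fun n => ?_))
    exact ENNReal.div_le_div_right (hG1 n ν) _
  refine le_of_forall_gt_imp_ge_of_dense fun e he => ?_
  rcases eq_or_ne e ⊤ with rfl | heT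
  · exact le_top
  refine le_of_forall_lt_imp_le_of_dense fun c hc => ?_
  have h1 := eventually_lt_of_lt_liminf (hc.trans_le hlim)
  have h2 := freq_of_liminf_lt _ (RD_anti μ) e he
  have h3 : ∀ m : ℕ, c ≤ e + C * ((2 ^ m : ℕ) : ℝ≥0∞)⁻¹ := by
    intro m
    refine le_of_freq _ _ (e * (11 + m + q : ℕ) + C * ((2 ^ m : ℕ) : ℝ≥0∞)⁻¹ * (q + 7 : ℕ)) ?_ ?_
    · have : ((2 ^ m : ℕ) : ℝ≥0∞)⁻¹ ≠ ⊤ := by simp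
      finiteness
    obtain ⟨n0, hn0⟩ := eventually_atTop.1 h1
    rw [frequently_atTop] at h2 ⊢
    intro a
    obtain ⟨k, hk, hk2⟩ := h2 (a + n0 + q + 10 + m)
    obtain ⟨n, rfl⟩ : ∃ n, k = n + q + 10 + m := ⟨k - (q + 10 + m), by omega⟩
    refine ⟨n, by omega, ?_⟩
    have h4 := hn0 n (by omega)
    simp only [div_eq_mul_inv] at h4
    rw [lintegral_mul_const _ (hGm n), ← div_eq_mul_inv, ENNReal.lt_div_iff_mul_lt
      (Or.inl (by simp; omega)) (Or.inl (ENNReal.natCast_ne_top _))] at h4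
    have h5 := lower_bound hT lam μ hbar ((1 / 2 : ℝ) ^ (n + q + 10 + m)) (by positivity)
      (2 ^ m) (by positivity) (C * ((n + (q + 7) : ℕ) : ℝ≥0∞)) (G n) (fun ν => by
        refine (hG2 n ν).trans (le_of_eq (congrArg _ ?_))
        rw [show n + q + 10 + m = n + (q + 7) + 3 + m by ring, pow_add _ _ m, pow_add _ _ 3]
        have : (1 / 2 : ℝ) ^ m * 2 ^ m = 1 := by rw [← mul_pow]; norm_num
        push_cast
        linear_combination (-(1 / 2 : ℝ) ^ (n + (q + 7))) * this) (hG3 n)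
    calc c * n ≤ c * ((n + q : ℕ) : ℝ≥0∞) := by gcongr; omega
      _ ≤ _ := h4.le
      _ ≤ _ := h5
      _ ≤ e * ((n + q + 10 + m : ℕ) + 1) + _ := add_le_add_left hk2 _
      _ = _ := by push_cast; ring
  have h6 : Tendsto (fun m : ℕ => e + C * ((2 ^ m : ℕ) : ℝ≥0∞)⁻¹) atTop (𝓝 (e + C * 0)) := by
    refine tendsto_const_nhds.add (ENNReal.Tendsto.const_mul ?_ (Or.inr hC))
    exact (ENNReal.tendsto_inv_nat_nhds_zero).comp (tendsto_pow_atTop_atTop_of_one_lt one_lt_two)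
  rw [mul_zero, add_zero] at h6
  exact ge_of_tendsto' h6 h3

theorem lrdim_le_urdim (μ : Measure X) : lrdim d T μ ≤ urdim d T μ :=
  liminf_le_limsup

end

end RDB

/-- Corollary 1.3: if the rate distortion dimension exists for `λ`-a.e. `ν`, then it exists
for the barycenter `μ` and equals the integral of the fiberwise dimensions. -/
theorem rdim_barycenter_of_ae_exists
    {X : Type*} [MetricSpace X] [CompactSpace X] [MeasurableSpace X] [BorelSpace X]
    (d : ℕ) (hd : 0 < d) (T : (Fin d → ℝ) → X → X) (hT : IsContAction d T)
    (hdim : umdim d T ≠ ⊤)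
    (lam : Measure (InvM X d T)) [IsProbabilityMeasure lam]
    (μ : Measure X) [IsProbabilityMeasure μ] (hμinv : MeasInvariant d T μ)
    (hbar : ∀ A : Set X, MeasurableSet A → μ A = ∫⁻ ν, (ν.1 : Measure X) A ∂lam)
    (hae : ∀ᵐ ν ∂lam, urdim d T (ν.1 : Measure X) = lrdim d T (ν.1 : Measure X)) :
    urdim d T μ = lrdim d T μ ∧
      urdim d T μ = ∫⁻ ν, urdim d T (ν.1 : Measure X) ∂lam := by
  have h1 := RDB.main_upper hd hT hdim lam μ hbar
  have h2 := RDB.main_lower hd hT hdim lam μ hbar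
  have h3 := RDB.lrdim_le_urdim (d := d) (T := T) μ
  rw [← lintegral_congr_ae hae] at h2
  exact ⟨le_antisymm (h1.trans h2) h3, le_antisymm h1 (h2.trans h3)⟩
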